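/- Every countable rooted digraph D contains a spanning subdigraph F that is simultaneously a vertex-flame and D-large. -/

import Mathlib

/-!  Common framework: digraphs as edge sets on a vertex type, directed paths,
path-systems, separations, flames and largeness. -/

universe u

variable {V : Type u}

/-- A directed path in the digraph on `V` with edge set `E`, given by its
(nonempty, repetition-free) list of vertices `start :: rest`. -/
structure Dipath (E : Set (V × V)) : Type u where
  start : V
  rest : List V
  chain : List.Chain (fun a b => (a, b) ∈ E) start rest
  nodup : (start :: rest).Nodup

namespace Dipath

variable {E : Set (V × V)}

/-- The list of vertices of the path. -/
def verts (p : Dipath E) : List V := p.start :: p.rest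

/-- The terminal vertex of the path. -/
def last (p : Dipath E) : V := (p.start :: p.rest).getLast (List.cons_ne_nil _ _)

/-- The set of vertices of the path. -/
def support (p : Dipath E) : Set V := {v | v ∈ p.verts}

/-- The internal vertices of the path (all vertices except the first and the last). -/
def internal (p : Dipath E) : Set V := {v | v ∈ p.rest.dropLast}

/-- The list of (directed) edges of the path. -/
def edges (p : Dipath E) : List (V × V) := p.verts.zip p.rest

/-- The set of edges of the path. -/
def edgeSet (p : Dipath E) : Set (V × V) := {e | e ∈ p.edges}

/-- The last edge of the path, if the path has at least one edge. -/
def lastEdge? (p : Dipath E) : Option (V × V) := p.edges.getLast?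

end Dipath

section Defs

variable (E : Set (V × V))

/-- The set of ingoing edges of `v`. -/
def inEdges (v : V) : Set (V × V) := {e ∈ E | e.2 = v}

/-- The set of initial vertices of a set of paths. -/
def initVerts {E : Set (V × V)} (P : Set (Dipath E)) : Set V := Dipath.start '' P

/-- The set of terminal vertices of a set of paths. -/
def termVerts {E : Set (V × V)} (P : Set (Dipath E)) : Set V := Dipath.last '' P

/-- The set of terminal edges of a set of paths. -/
def termEdges {E : Set (V × V)} (P : Set (Dipath E)) : Set (V × V) :=
  {e | ∃ p ∈ P, p.lastEdge? = some e}

/-- An `(r,v)`-path-system: a set of pairwise internally disjoint directed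
paths from `r` to `v`. -/
def IsRVSystem (r v : V) (P : Set (Dipath E)) : Prop :=
  (∀ p ∈ P, p.start = r ∧ p.last = v) ∧
    P.Pairwise fun p q => p.support ∩ q.support ⊆ {r, v}

/-- An `(r,v)`-separation: a set of vertices avoiding `r` and `v` and meeting
every directed path from `r` to `v`. -/
def IsSeparation (r v : V) (S : Set V) : Prop :=
  r ∉ S ∧ v ∉ S ∧ ∀ p : Dipath E, p.start = r → p.last = v → (p.support ∩ S).Nonempty

/-- A set of paths `P` and a vertex set `S` are orthogonal:  every path of `P`
meets `S` in exactly one vertex and every vertex of `S` lies on a path of `P`. -/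
def Orthogonal {E : Set (V × V)} (P : Set (Dipath E)) (S : Set V) : Prop :=
  (∀ p ∈ P, ∃! x, x ∈ p.support ∩ S) ∧ ∀ x ∈ S, ∃ p ∈ P, x ∈ p.support

/-- An Erdős–Menger `(r,v)`-path-system: one orthogonal to some `(r,v)`-separation. -/
def IsEMSystem (r v : V) (P : Set (Dipath E)) : Prop :=
  IsRVSystem E r v P ∧ ∃ S, IsSeparation E r v S ∧ Orthogonal P S

/-- An Erdős–Menger `(r,v)`-separation: one orthogonal to some `(r,v)`-path-system. -/
def IsEMSeparation (r v : V) (S : Set V) : Prop :=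
  IsSeparation E r v S ∧ ∃ P : Set (Dipath E), IsRVSystem E r v P ∧ Orthogonal P S

/-- `𝒢_E(v)` (with root `r`): the collection of edge sets `I` that arise as the set of
terminal edges of an internally disjoint `(r,v)`-path-system in `E`. -/
def GSet (r v : V) : Set (Set (V × V)) :=
  {I | ∃ P : Set (Dipath E), IsRVSystem E r v P ∧ termEdges P = I}

/-- A vertex-flame (with root `r`): for every `v ≠ r`, the whole in-edge set of `v`
is the terminal edge set of an internally disjoint `(r,v)`-path-system. -/
def IsFlame (r : V) : Prop := ∀ v, v ≠ r → inEdges E v ∈ GSet E r v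

/-- `L` is `v`-large with respect to the digraph `E` rooted at `r`: `L` contains `rv`
whenever `E` does, and some Erdős–Menger `(r,v)`-path-system of `E - rv` lies in `L`. -/
def VLarge (r : V) (L : Set (V × V)) (v : V) : Prop :=
  ((r, v) ∈ E → (r, v) ∈ L) ∧
    ∃ P : Set (Dipath (E \ {(r, v)})),
      IsEMSystem (E \ {(r, v)}) r v P ∧ ∀ p ∈ P, p.edgeSet ⊆ L

/-- `L` is large with respect to the digraph `E` rooted at `r`. -/
def Large (r : V) (L : Set (V × V)) : Prop := ∀ v, v ≠ r → VLarge E r L v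

/-- An `(X,Y)`-path: from `X` to `Y`, internally disjoint from `X ∪ Y`. -/
def IsXYPath (X Y : Set V) (p : Dipath E) : Prop :=
  p.start ∈ X ∧ p.last ∈ Y ∧ ∀ w ∈ p.internal, w ∉ X ∪ Y

/-- An `(X,Y)`-path-system: pairwise disjoint `(X,Y)`-paths. -/
def IsXYSystem (X Y : Set V) (P : Set (Dipath E)) : Prop :=
  (∀ p ∈ P, IsXYPath E X Y p) ∧ P.Pairwise fun p q => Disjoint p.support q.support

/-- `X` is joinable to `Y`: some `(X,Y)`-path-system covers `X` with its initial vertices. -/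
def Joinable (X Y : Set V) : Prop :=
  ∃ P : Set (Dipath E), IsXYSystem E X Y P ∧ initVerts P = X

/-- `X` is incompressible to `Y`: `X` is joinable to `Y` and every witnessing
path-system covers `Y` with its terminal vertices. -/
def Incompressible (X Y : Set V) : Prop :=
  Joinable E X Y ∧
    ∀ P : Set (Dipath E), IsXYSystem E X Y P → initVerts P = X → termVerts P = Y

/-- An `(X,Y)`-separation: a vertex set meeting every `(X,Y)`-path. -/
def IsXYSeparation (X Y : Set V) (S : Set V) : Prop :=
  ∀ p : Dipath E, IsXYPath E X Y p → (p.support ∩ S).Nonempty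

/-- An Erdős–Menger `(X,Y)`-separation: one orthogonal to some `(X,Y)`-path-system. -/
def IsEMXYSeparation (X Y : Set V) (S : Set V) : Prop :=
  IsXYSeparation E X Y S ∧ ∃ P : Set (Dipath E), IsXYSystem E X Y P ∧ Orthogonal P S

/-- `X'` is `(X,Y)`-finitely extendable: every `O` with `X' ⊆ O ⊆ X` and `O \ X'`
finite is joinable to `Y`. -/
def FinExtendable (X Y X' : Set V) : Prop :=
  X' ⊆ X ∧ ∀ O, X' ⊆ O → O ⊆ X → (O \ X').Finite → Joinable E O Y

/-- `S` separates the vertex `y` from `r`:  every directed path from `r` to `y` meets `S`. -/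
def SeparatesFrom (r : V) (S : Set V) (y : V) : Prop :=
  ∀ p : Dipath E, p.start = r → p.last = y → (p.support ∩ S).Nonempty

/-- An `(X,y)`-path: from a vertex of `X` to `y`, internally disjoint from `X`. -/
def IsXyPath (X : Set V) (y : V) (p : Dipath E) : Prop :=
  p.start ∈ X ∧ p.last = y ∧ ∀ w ∈ p.internal, w ∉ X

/-- An `(X,y)`-path-system: `(X,y)`-paths, pairwise disjoint except possibly at `y`. -/
def IsXySystem (X : Set V) (y : V) (P : Set (Dipath E)) : Prop :=
  (∀ p ∈ P, IsXyPath E X y p) ∧ P.Pairwise fun p q => p.support ∩ q.support ⊆ {y}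

/-- An `(r,S)`-path: from `r` to a vertex of `S`, internally disjoint from `S`. -/
def IsRSPath (r : V) (S : Set V) (p : Dipath E) : Prop :=
  p.start = r ∧ p.last ∈ S ∧ ∀ w ∈ p.internal, w ∉ S

/-- An `(r,S)`-path-system: `(r,S)`-paths, pairwise disjoint apart from `r`. -/
def IsRSSystem (r : V) (S : Set V) (P : Set (Dipath E)) : Prop :=
  (∀ p ∈ P, IsRSPath E r S p) ∧ P.Pairwise fun p q => p.support ∩ q.support ⊆ {r}

/-- `E` is a `G`-quasi-flame (with root `r`): for every `v ≠ r`, every set `I` of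
ingoing edges of `v` with `I \ inEdges G v` finite lies in `𝒢_E(v)`. -/
def QuasiFlame (r : V) (G : Set (V × V)) : Prop :=
  ∀ v, v ≠ r → ∀ I, I ⊆ inEdges E v → (I \ inEdges G v).Finite → I ∈ GSet E r v

/-- The local connectivity `κ_E(r,v)`: the maximum size of an internally disjoint
`(r,v)`-path-system. -/
noncomputable def kappa (r v : V) : ℕ :=
  sSup {n | ∃ P : Set (Dipath E), IsRVSystem E r v P ∧ P.Finite ∧ P.ncard = n}

end Defs


namespace Flm
open Set

/-- closed out-neighbourhood -/
def nb (G : V → V → Prop) (Z : Set V) : Set V := {t | t ∈ Z ∨ ∃ z ∈ Z, G z t}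

def rho (G : V → V → Prop) (z t : V) : Prop := z = t ∨ G z t

lemma mem_nb_iff {G : V → V → Prop} {Z : Set V} {t : V} :
    t ∈ nb G Z ↔ ∃ z ∈ Z, rho G z t := by
  constructor
  · rintro (h | ⟨z, hz, h⟩)
    · exact ⟨t, h, Or.inl rfl⟩
    · exact ⟨z, hz, Or.inr h⟩
  · rintro ⟨z, hz, rfl | h⟩
    · exact Or.inl hz
    · exact Or.inr ⟨z, hz, h⟩

lemma nb_mono {G : V → V → Prop} {Z Z' : Set V} (h : Z ⊆ Z') : nb G Z ⊆ nb G Z' := by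
  rintro t (h1 | ⟨z, hz, h1⟩)
  · exact Or.inl (h h1)
  · exact Or.inr ⟨z, h hz, h1⟩

lemma subset_nb {G : V → V → Prop} {Z : Set V} : Z ⊆ nb G Z := fun _ h => Or.inl h

/-- no infinite forward orbit inside `D` -/
def NoRay (h : V → V) (D : Set V) : Prop :=
  ¬ ∃ q : ℕ → V, Function.Injective q ∧ ∀ n, q n ∈ D ∧ h (q n) = q (n + 1)

/-- no infinite backward orbit inside `D` -/
def NoBack (h : V → V) (D : Set V) : Prop :=
  ¬ ∃ q : ℕ → V, Function.Injective q ∧ ∀ n, q n ∈ D ∧ h (q (n + 1)) = q n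

lemma NoRay.mono {h : V → V} {D D' : Set V} (H : NoRay h D) (hd : D' ⊆ D) : NoRay h D' := by
  rintro ⟨q, hq, h1⟩
  exact H ⟨q, hq, fun n => ⟨hd (h1 n).1, (h1 n).2⟩⟩

lemma inj_avoid {q : ℕ → V} (hq : Function.Injective q) {X : Set V} (hX : X.Finite) :
    ∃ N, ∀ n, N ≤ n → q n ∉ X := by
  have : (q ⁻¹' X).Finite := hX.preimage hq.injOn
  obtain ⟨N, hN⟩ := this.bddAbove
  exact ⟨N + 1, fun n hn hx => by have := hN hx; omega⟩

lemma NoRay.finite_change {h h' : V → V} {D D' : Set V} (H : NoRay h D)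
    (hf : {t | h' t ≠ h t}.Finite) (hd : (D' \ D).Finite) : NoRay h' D' := by
  rintro ⟨q, hq, h1⟩
  obtain ⟨N, hN⟩ := inj_avoid hq (hf.union hd)
  refine H ⟨fun n => q (N + n), fun a b hab => by have := hq hab; omega, fun n => ?_⟩
  have h2 := hN (N + n) (by omega)
  have h3 := h1 (N + n)
  simp only [mem_union, mem_setOf_eq, mem_diff, not_or, not_and, not_not] at h2
  exact ⟨h2.2 h3.1, by rw [← h2.1]; exact h3.2⟩

lemma NoBack.finite_change {h h' : V → V} {D D' : Set V} (H : NoBack h D)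
    (hf : {t | h' t ≠ h t}.Finite) (hd : (D' \ D).Finite) : NoBack h' D' := by
  rintro ⟨q, hq, h1⟩
  obtain ⟨N, hN⟩ := inj_avoid hq (hf.union hd)
  refine H ⟨fun n => q (N + n), fun a b hab => by have := hq hab; omega, fun n => ?_⟩
  have h2 := hN (N + n) (by omega)
  have h4 := hN (N + n + 1) (by omega)
  have h3 := h1 (N + n)
  simp only [mem_union, mem_setOf_eq, mem_diff, not_or, not_and, not_not] at h2 h4
  exact ⟨h2.2 h3.1, by
    show h (q (N + (n+1))) = _
    rw [← add_assoc, ← h4.1]; exact h3.2⟩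

/-- matching conditions on a domain -/
structure Mt (G : V → V → Prop) (D Z : Set V) (h : V → V) : Prop where
  maps : ∀ t ∈ D, h t ∈ Z
  rel : ∀ t ∈ D, rho G (h t) t
  inj : InjOn h D

lemma Mt.mono {G : V → V → Prop} {D Z D' : Set V} {h : V → V} (H : Mt G D Z h) (hd : D' ⊆ D) :
    Mt G D' Z h :=
  ⟨fun t ht => H.maps t (hd ht), fun t ht => H.rel t (hd ht), H.inj.mono hd⟩

/-- alternating reachability -/
def AltReach (G : V → V → Prop) (D0 : Set V) (h : V → V) (Q0 : Set V) : Set V :=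
  {d | ∃ (n : ℕ) (x : ℕ → V), x 0 ∈ Q0 ∧ (∀ i < n, x (i+1) ∈ D0 ∧ rho G (h (x (i+1))) (x i)) ∧
    InjOn x (Iic n) ∧ x n = d}

lemma altReach_start {G : V → V → Prop} {D0 Q0 : Set V} {h : V → V} : Q0 ⊆ AltReach G D0 h Q0 := by
  intro q hq
  refine ⟨0, fun _ => q, hq, by simp, ?_, rfl⟩
  intro a ha b hb _
  simp at ha hb; omega

lemma altReach_step {G : V → V → Prop} {D0 Q0 : Set V} {h : V → V} {q d : V}
    (hq : q ∈ AltReach G D0 h Q0) (hd : d ∈ D0) (hr : rho G (h d) q) :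
    d ∈ AltReach G D0 h Q0 := by
  obtain ⟨n, x, h0, hs, hi, rfl⟩ := hq
  by_cases hx : ∃ i ≤ n, x i = d
  · obtain ⟨i, hi', rfl⟩ := hx
    exact ⟨i, x, h0, fun j hj => hs j (by omega), hi.mono (Iic_subset_Iic.2 hi'), rfl⟩
  · push Not at hx
    refine ⟨n + 1, fun i => if i ≤ n then x i else d, by simpa using h0, ?_, ?_, by simp⟩
    · intro i hi'
      by_cases hin : i < n
      · have h1 : i + 1 ≤ n := hin
        have h2 : i ≤ n := hin.le
        simp only [h1, h2, if_true]
        exact hs i hin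
      · have h1 : ¬ (i + 1 ≤ n) := by omega
        have h2 : i ≤ n := by omega
        have h3 : i = n := by omega
        simp only [h1, h2, if_true, if_false]
        subst h3
        exact ⟨hd, hr⟩
    · intro a ha b hb hab
      simp only [mem_Iic] at ha hb
      dsimp only at hab
      split_ifs at hab with h1 h2 h2
      · exact hi h1 h2 hab
      · exact absurd hab (hx a h1)
      · exact absurd hab.symm (hx b h2)
      · omega

lemma core_flip {G : V → V → Prop} {D0 Z : Set V} (n : ℕ) : ∀ {h : V → V} (x : ℕ → V) (z : V),
    Mt G D0 Z h → x 0 ∉ D0 → (∀ i < n, x (i+1) ∈ D0 ∧ rho G (h (x (i+1))) (x i)) →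
    InjOn x (Iic n) → z ∈ Z → z ∉ h '' D0 → rho G z (x n) →
    ∃ h' : V → V, {t | h' t ≠ h t}.Finite ∧ Mt G (insert (x 0) D0) Z h' ∧
      h' '' (insert (x 0) D0) = insert z (h '' D0) := by
  classical
  induction n with
  | zero =>
    intro h x z hM hx0 _ _ hz hzr hrho
    have hne : ∀ t ∈ D0, t ≠ x 0 := fun t ht e => hx0 (e ▸ ht)
    refine ⟨Function.update h (x 0) z, ?_, ⟨?_, ?_, ?_⟩, ?_⟩
    · refine (finite_singleton (x 0)).subset ?_
      intro t ht
      by_contra hne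
      exact ht (Function.update_of_ne hne _ _)
    · rintro t (rfl | ht)
      · simpa using hz
      · rw [Function.update_of_ne (hne t ht)]; exact hM.maps t ht
    · rintro t (rfl | ht)
      · simpa using hrho
      · rw [Function.update_of_ne (hne t ht)]; exact hM.rel t ht
    · rintro a (rfl | ha) b (rfl | hb) hab
      · rfl
      · rw [Function.update_self, Function.update_of_ne (hne b hb)] at hab
        exact absurd ⟨b, hb, hab.symm⟩ hzr
      · rw [Function.update_self, Function.update_of_ne (hne a ha)] at hab
        exact absurd ⟨a, ha, hab⟩ hzr
      · rw [Function.update_of_ne (hne a ha), Function.update_of_ne (hne b hb)] at hab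
        exact hM.inj ha hb hab
    · rw [image_insert_eq, Function.update_self]
      congr 1
      exact image_congr fun t ht => Function.update_of_ne (hne t ht) _ _
  | succ n ih =>
    intro h x z hM hx0 hs hi hz hzr hrho
    have hxn := (hs n (by omega)).1
    set h1 := Function.update h (x (n+1)) z with hh1
    have hother : ∀ t, t ≠ x (n+1) → h1 t = h t := fun t ht => Function.update_of_ne ht _ _
    have hself : h1 (x (n+1)) = z := Function.update_self _ _ _
    have hM1 : Mt G D0 Z h1 := by
      refine ⟨?_, ?_, ?_⟩
      · intro t ht
        by_cases e : t = x (n+1)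
        · rw [e, hself]; exact hz
        · rw [hother t e]; exact hM.maps t ht
      · intro t ht
        by_cases e : t = x (n+1)
        · rw [e, hself]; exact hrho
        · rw [hother t e]; exact hM.rel t ht
      · intro a ha b hb hab
        by_cases ea : a = x (n+1) <;> by_cases eb : b = x (n+1)
        · rw [ea, eb]
        · rw [ea, hself, hother b eb] at hab
          exact absurd ⟨b, hb, hab.symm⟩ hzr
        · rw [eb, hself, hother a ea] at hab
          exact absurd ⟨a, ha, hab⟩ hzr
        · rw [hother a ea, hother b eb] at hab
          exact hM.inj ha hb hab
    have hyr : h (x (n+1)) ∉ h1 '' D0 := by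
      rintro ⟨t, ht, e⟩
      by_cases et : t = x (n+1)
      · rw [et, hself] at e
        exact hzr ⟨x (n+1), hxn, e.symm⟩
      · rw [hother t et] at e
        exact et (hM.inj ht hxn e)
    have hxi : ∀ i, i ≤ n → x i ≠ x (n+1) := by
      intro i hin e
      have := hi (mem_Iic.2 (by omega : i ≤ n+1)) (mem_Iic.2 le_rfl) e
      omega
    obtain ⟨h', hf, hM', hr⟩ := ih x (h (x (n+1))) hM1 hx0
      (fun i hin => ⟨(hs i (by omega)).1, by
        rw [hother _ (hxi (i+1) hin)]; exact (hs i (by omega)).2⟩)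
      (hi.mono (Iic_subset_Iic.2 (by omega))) (hM.maps _ hxn) hyr (hs n (by omega)).2
    refine ⟨h', ?_, hM', ?_⟩
    · refine (hf.union (finite_singleton (x (n+1)))).subset ?_
      intro t ht
      by_cases e : t = x (n+1)
      · right; exact e
      · left
        simp only [mem_setOf_eq] at ht ⊢
        rwa [hother t e]
    · rw [hr]
      ext y
      simp only [mem_insert_iff, mem_image]
      constructor
      · rintro (rfl | ⟨t, ht, rfl⟩)
        · right; exact ⟨_, hxn, rfl⟩
        · by_cases e : t = x (n+1)
          · left; rw [e, hself]
          · right; exact ⟨t, ht, (hother t e).symm⟩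
      · rintro (rfl | ⟨t, ht, rfl⟩)
        · right; exact ⟨_, hxn, hself⟩
        · by_cases e : t = x (n+1)
          · left; rw [e]
          · right; exact ⟨t, ht, hother t e⟩

/-- The augmentation dichotomy. -/
lemma core {G : V → V → Prop} {D0 Z Q0 : Set V} {h : V → V} (hM : Mt G D0 Z h)
    (hQ : ∀ q ∈ Q0, q ∉ D0) :
    (∃ q0 ∈ Q0, ∃ z0 ∈ Z, z0 ∉ h '' D0 ∧ ∃ h' : V → V, {t | h' t ≠ h t}.Finite ∧
      Mt G (insert q0 D0) Z h' ∧ h' '' (insert q0 D0) = insert z0 (h '' D0)) ∨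
    (∃ Z' ⊆ Z, (∀ z ∈ Z, z ∉ h '' D0 → z ∈ Z') ∧ (∀ q ∈ Q0, q ∉ nb G Z') ∧
      ∀ D', D' ⊆ D0 → D' ⊆ nb G Z' → Mt G D' Z' h) := by
  by_cases hs : ∃ q ∈ AltReach G D0 h Q0, ∃ z ∈ Z, z ∉ h '' D0 ∧ rho G z q
  · left
    obtain ⟨q, ⟨n, x, h0, hs, hi, rfl⟩, z, hz, hzr, hrho⟩ := hs
    exact ⟨x 0, h0, z, hz, hzr, core_flip n x z hM (hQ _ h0) hs hi hz hzr hrho⟩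
  · right
    push Not at hs
    refine ⟨{z ∈ Z | ∀ q ∈ AltReach G D0 h Q0, ¬ rho G z q}, fun z hz => hz.1, ?_, ?_, ?_⟩
    · intro z hz hzr
      exact ⟨hz, fun q hq => hs q hq z hz hzr⟩
    · intro q hq hn
      obtain ⟨z, hz, hr⟩ := mem_nb_iff.1 hn
      exact hz.2 q (altReach_start hq) hr
    · intro D' hD' hn
      have := hM.mono hD'
      refine ⟨fun t ht => ⟨this.maps t ht, ?_⟩, this.rel, this.inj⟩
      intro q hq hr
      have htr := altReach_step hq (hD' ht) hr
      obtain ⟨z, hz, hr'⟩ := mem_nb_iff.1 (hn ht)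
      exact hz.2 t htr hr'

end Flm

namespace Flm
open Set

structure Wave (G : V → V → Prop) (A B Z : Set V) (h : V → V) : Prop where
  disj : ∀ z ∈ Z, z ∉ B
  mt : Mt G (nb G Z \ A) Z h
  noray : NoRay h (nb G Z \ A)

def Unh (G : V → V → Prop) (A B : Set V) : Prop :=
  ∀ Z h, Wave G A B Z h → Z ⊆ h '' (nb G Z \ A)

def GWave (G : V → V → Prop) (A B Z : Set V) (h : V → V) : Prop :=
  Wave G A B Z h ∧ ∀ Z' h', Wave G A B Z' h' → Z' ⊆ Z

lemma Wave.empty (G : V → V → Prop) (A B : Set V) (h : V → V) : Wave G A B ∅ h := by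
  have : nb G ∅ \ A = ∅ := by ext t; simp [nb]
  refine ⟨by simp, ?_, ?_⟩
  · rw [this]; exact ⟨by simp, by simp, by simp⟩
  · rw [this]; rintro ⟨q, _, h1⟩; exact (h1 0).1

lemma nb_union (G : V → V → Prop) (Z Z' : Set V) : nb G (Z ∪ Z') = nb G Z ∪ nb G Z' := by
  ext t
  simp only [mem_nb_iff, mem_union]
  constructor
  · rintro ⟨z, h | h, hr⟩
    · exact Or.inl ⟨z, h, hr⟩
    · exact Or.inr ⟨z, h, hr⟩
  · rintro (⟨z, h, hr⟩ | ⟨z, h, hr⟩)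
    · exact ⟨z, Or.inl h, hr⟩
    · exact ⟨z, Or.inr h, hr⟩

/-- Extension lemma -/
lemma Wave.ext {G : V → V → Prop} {A B Z Z1 : Set V} {h h1 : V → V} (W : Wave G A B Z h)
    (hB : ∀ z ∈ Z1, z ∉ B) (hM : Mt G (nb G Z1 \ (nb G Z ∪ A)) Z1 h1)
    (hR : NoRay h1 (nb G Z1 \ (nb G Z ∪ A))) :
    ∃ h2, (∀ t ∈ nb G Z, h2 t = h t) ∧ (∀ t ∉ nb G Z, h2 t = h1 t) ∧ Wave G A B (Z ∪ Z1) h2 := by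
  classical
  let h2 : V → V := fun t => if t ∈ nb G Z then h t else h1 t
  have e1 : ∀ t ∈ nb G Z, h2 t = h t := fun t ht => if_pos ht
  have e2 : ∀ t ∉ nb G Z, h2 t = h1 t := fun t ht => if_neg ht
  have key : ∀ t, t ∈ nb G (Z ∪ Z1) → t ∉ A → t ∉ nb G Z → t ∈ nb G Z1 \ (nb G Z ∪ A) := by
    intro t ht hA hn
    rw [nb_union] at ht
    exact ⟨ht.resolve_left hn, by simp [hn, hA]⟩
  have off : ∀ t ∈ nb G Z1 \ (nb G Z ∪ A), h1 t ∉ Z := fun t ht hz =>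
    ht.2 (Or.inl (mem_nb_iff.2 ⟨_, hz, hM.rel t ht⟩))
  refine ⟨h2, e1, e2, ?_, ⟨?_, ?_, ?_⟩, ?_⟩
  · rintro z (hz | hz)
    · exact W.disj z hz
    · exact hB z hz
  · rintro t ⟨ht, hA⟩
    by_cases hn : t ∈ nb G Z
    · rw [e1 t hn]; exact Or.inl (W.mt.maps t ⟨hn, hA⟩)
    · rw [e2 t hn]; exact Or.inr (hM.maps t (key t ht hA hn))
  · rintro t ⟨ht, hA⟩
    by_cases hn : t ∈ nb G Z
    · rw [e1 t hn]; exact (W.mt.rel t ⟨hn, hA⟩)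
    · rw [e2 t hn]; exact (hM.rel t (key t ht hA hn))
  · rintro t ⟨ht, hA⟩ t' ⟨ht', hA'⟩ he
    by_cases hn : t ∈ nb G Z <;> by_cases hn' : t' ∈ nb G Z
    · rw [e1 t hn, e1 t' hn'] at he
      exact W.mt.inj ⟨hn, hA⟩ ⟨hn', hA'⟩ he
    · rw [e1 t hn, e2 t' hn'] at he
      exact absurd (he ▸ W.mt.maps t ⟨hn, hA⟩) (off t' (key t' ht' hA' hn'))
    · rw [e2 t hn, e1 t' hn'] at he
      exact absurd (he ▸ W.mt.maps t' ⟨hn', hA'⟩) (off t (key t ht hA hn))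
    · rw [e2 t hn, e2 t' hn'] at he
      exact hM.inj (key t ht hA hn) (key t' ht' hA' hn') he
  · rintro ⟨q, hq, h3⟩
    by_cases hN : ∃ N, q N ∈ nb G Z
    · obtain ⟨N, hN⟩ := hN
      have hall : ∀ n, q (N + n) ∈ nb G Z := by
        intro n
        induction n with
        | zero => exact hN
        | succ n ih =>
          have := h3 (N + n)
          rw [e1 _ ih] at this
          rw [← add_assoc, ← this.2]
          exact subset_nb (W.mt.maps _ ⟨ih, this.1.2⟩)
      refine W.noray ⟨fun n => q (N + n), fun a b hab => by have := hq hab; omega, fun n => ?_⟩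
      have := h3 (N + n)
      rw [e1 _ (hall n)] at this
      exact ⟨⟨hall n, this.1.2⟩, this.2⟩
    · push Not at hN
      refine hR ⟨q, hq, fun n => ⟨key _ (h3 n).1.1 (h3 n).1.2 (hN n), ?_⟩⟩
      rw [← e2 _ (hN n)]; exact (h3 n).2

lemma noninc_const (f : ℕ → ℕ) (hf : ∀ n, f (n + 1) ≤ f n) : ∃ N, ∀ n, f (N + n) = f N := by
  have ha : Antitone f := antitone_nat_of_succ_le hf
  obtain ⟨N, hN⟩ := Nat.sInf_mem (s := range f) ⟨f 0, 0, rfl⟩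
  refine ⟨N, fun n => le_antisymm (ha (by omega)) ?_⟩
  rw [hN]; exact Nat.sInf_le ⟨_, rfl⟩

lemma exists_gwave [Countable V] (G : V → V → Prop) (A B : Set V) :
    ∃ Z h, GWave G A B Z h := by
  classical
  by_cases hV : Nonempty V
  swap
  · refine ⟨∅, fun x => x, Wave.empty _ _ _ _, fun Z' _ _ z => (hV ⟨z⟩).elim⟩
  obtain ⟨en, hen⟩ := exists_surjective_nat V
  have : ∀ v : V, ∃ W : Set V × (V → V), Wave G A B W.1 W.2 ∧
      ∀ Z' h', Wave G A B Z' h' → v ∈ Z' → v ∈ W.1 := by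
    intro v
    by_cases h : ∃ Z' h', Wave G A B Z' h' ∧ v ∈ Z'
    · obtain ⟨Z', h', hw, hv⟩ := h
      exact ⟨(Z', h'), hw, fun _ _ _ _ => hv⟩
    · refine ⟨(∅, id), Wave.empty _ _ _ _, fun Z' h' hw hv => (h ⟨Z', h', hw, hv⟩).elim⟩
  choose W hW hWv using this
  let ZZ : ℕ → Set V := fun i => (W (en i)).1
  let hh : ℕ → V → V := fun i => (W (en i)).2
  have hw : ∀ i, Wave G A B (ZZ i) (hh i) := fun i => hW _
  let Z : Set V := ⋃ i, ZZ i
  have hnb : ∀ t ∈ nb G Z, ∃ i, t ∈ nb G (ZZ i) := by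
    intro t ht
    obtain ⟨z, hz, hr⟩ := mem_nb_iff.1 ht
    obtain ⟨i, hi⟩ := mem_iUnion.1 hz
    exact ⟨i, mem_nb_iff.2 ⟨z, hi, hr⟩⟩
  let ix : V → ℕ := fun t => if h : ∃ i, t ∈ nb G (ZZ i) then Nat.find h else 0
  have ix1 : ∀ t ∈ nb G Z, t ∈ nb G (ZZ (ix t)) := by
    intro t ht
    have h := hnb t ht
    simp only [ix, dif_pos h]
    exact Nat.find_spec h
  have ix2 : ∀ t i, t ∈ nb G (ZZ i) → ix t ≤ i := by
    intro t i hi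
    have h : ∃ i, t ∈ nb G (ZZ i) := ⟨i, hi⟩
    simp only [ix, dif_pos h]
    exact Nat.find_min' h hi
  let h : V → V := fun t => hh (ix t) t
  have hmap : ∀ t ∈ nb G Z \ A, h t ∈ ZZ (ix t) := fun t ht => (hw _).mt.maps t ⟨ix1 t ht.1, ht.2⟩
  have hrel : ∀ t ∈ nb G Z \ A, rho G (h t) t := fun t ht => (hw _).mt.rel t ⟨ix1 t ht.1, ht.2⟩
  refine ⟨Z, h, ⟨?_, ⟨?_, hrel, ?_⟩, ?_⟩, ?_⟩
  · intro z hz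
    obtain ⟨i, hi⟩ := mem_iUnion.1 hz
    exact (hw i).disj z hi
  · intro t ht
    exact mem_iUnion.2 ⟨_, hmap t ht⟩
  · intro t ht t' ht' he
    have a1 : ix t' ≤ ix t := ix2 _ _ (mem_nb_iff.2 ⟨_, hmap t ht, he ▸ hrel t' ht'⟩)
    have a2 : ix t ≤ ix t' := ix2 _ _ (mem_nb_iff.2 ⟨_, hmap t' ht', he ▸ hrel t ht⟩)
    have a3 : ix t = ix t' := le_antisymm a2 a1
    have b1 := ix1 t ht.1
    have b2 := ix1 t' ht'.1
    simp only [h] at he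
    rw [a3] at b1 he
    exact (hw _).mt.inj ⟨b1, ht.2⟩ ⟨b2, ht'.2⟩ he
  · rintro ⟨q, hq, h3⟩
    have hdec : ∀ n, ix (q (n + 1)) ≤ ix (q n) := fun n => by
      apply ix2
      rw [← (h3 n).2]
      exact subset_nb (hmap _ (h3 n).1)
    obtain ⟨N, hN⟩ := noninc_const (fun n => ix (q n)) hdec
    replace hN : ∀ n, ix (q (N + n)) = ix (q N) := hN
    refine (hw (ix (q N))).noray ⟨fun n => q (N + n), fun a b hab => by have := hq hab; omega,
      fun n => ⟨⟨?_, (h3 _).1.2⟩, ?_⟩⟩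
    · rw [← hN n]; exact ix1 _ (h3 _).1.1
    · have := (h3 (N + n)).2
      simp only [h] at this
      rw [hN n] at this
      exact this
  · intro Z' h' hw' z hz
    obtain ⟨i, hi⟩ := hen z
    refine mem_iUnion.2 ⟨i, ?_⟩
    show z ∈ (W (en i)).1
    rw [hi]
    exact hWv z Z' h' hw' hz

/-- beyond the greatest wave there are no nonempty waves -/
lemma beyond {G : V → V → Prop} {A B Z : Set V} {h : V → V} (W : GWave G A B Z h) :
    Unh G (nb G Z ∪ A) (B ∪ Z) := by
  intro Z1 h1 W1
  obtain ⟨h2, _, _, h3⟩ := W.1.ext (fun z hz hb => W1.disj z hz (Or.inl hb)) W1.mt W1.noray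
  intro z hz
  exact absurd (Or.inr (W.2 _ _ h3 (Or.inr hz))) (W1.disj z hz)

lemma Unh.antitone {G : V → V → Prop} {A A' B : Set V} (H : Unh G A B) (hA : A' ⊆ A) :
    Unh G A' B := by
  intro Z h W
  have hs : nb G Z \ A ⊆ nb G Z \ A' := sdiff_subset_sdiff_right hA
  exact (H Z h ⟨W.disj, W.mt.mono hs, W.noray.mono hs⟩).trans (image_mono hs)

lemma Unh.monoB {G : V → V → Prop} {A B B' : Set V} (H : Unh G A B) (hB : B ⊆ B') :
    Unh G A B' := by
  intro Z h W
  exact H Z h ⟨fun z hz hb => W.disj z hz (hB hb), W.mt, W.noray⟩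

lemma hindered_gwave {G : V → V → Prop} {A B Z : Set V} {h : V → V} (W : GWave G A B Z h)
    (H : ¬ Unh G A B) : ∃ h', GWave G A B Z h' ∧ ¬ Z ⊆ h' '' (nb G Z \ A) := by
  unfold Unh at H
  push Not at H
  obtain ⟨Z1, h1, W1, hz⟩ := H
  obtain ⟨z, hz, hz'⟩ := not_subset.1 hz
  have hsub := W.2 _ _ W1
  have hd : nb G Z \ (nb G Z1 ∪ A) ⊆ nb G Z \ A := fun t ht => ⟨ht.1, fun h => ht.2 (Or.inr h)⟩
  obtain ⟨h2, e1, e2, h3⟩ := W1.ext W.1.disj (W.1.mt.mono hd) (W.1.noray.mono hd)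
  rw [union_eq_self_of_subset_left hsub] at h3
  refine ⟨h2, ⟨h3, W.2⟩, fun hs => ?_⟩
  obtain ⟨t, ht, rfl⟩ := hs (hsub hz)
  have hn : t ∈ nb G Z1 := mem_nb_iff.2 ⟨_, hz, h3.mt.rel t ht⟩
  exact hz' ⟨t, ⟨hn, ht.2⟩, (e1 t hn).symm⟩

/-- w2 -/
lemma unh_insert {G : V → V → Prop} {A B Z : Set V} {h : V → V} (H : Unh G A B)
    (W : GWave G A B Z h) {x : V} (hx : x ∉ nb G Z ∪ A) : Unh G (insert x A) (insert x B) := by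
  by_contra hc
  unfold Unh at hc
  push Not at hc
  obtain ⟨Z', h', W', hz⟩ := hc
  obtain ⟨z, hz, hz'⟩ := not_subset.1 hz
  have hB : ∀ z ∈ Z', z ∉ B := fun z hz hb => W'.disj z hz (Or.inr hb)
  have hxA : x ∉ A := fun h => hx (Or.inr h)
  by_cases hxn : x ∈ nb G Z'
  swap
  · have he : nb G Z' \ insert x A = nb G Z' \ A := by
      ext t
      simp only [mem_sdiff, mem_insert_iff, not_or, and_congr_right_iff, and_iff_right_iff_imp]
      rintro ht _ rfl
      exact hxn ht
    have := H Z' h' ⟨hB, he ▸ W'.mt, he ▸ W'.noray⟩ hz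
    rw [← he] at this
    exact hz' this
  have he : insert x (nb G Z' \ insert x A) = nb G Z' \ A := by
    ext t
    simp only [mem_sdiff, mem_insert_iff, not_or]
    constructor
    · rintro (rfl | h)
      · exact ⟨hxn, hxA⟩
      · exact ⟨h.1, h.2.2⟩
    · intro h
      by_cases e : t = x
      · exact Or.inl e
      · exact Or.inr ⟨h.1, e, h.2⟩
  rcases core W'.mt (Q0 := {x}) (by simp) with ⟨q0, hq0, z0, hz0, hz0', h2, hf, hM, him⟩ | ⟨Z2, hs, hu, hq, hM⟩
  · obtain rfl : q0 = x := hq0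
    rw [he] at hM
    have hW : Wave G A B Z' h2 := ⟨hB, hM, W'.noray.finite_change hf (by
      rw [← he]; refine (finite_singleton q0).subset ?_; rintro t ⟨h1 | h1, h2⟩
      · exact h1
      · exact (h2 h1).elim)⟩
    exact hx (Or.inl (nb_mono (W.2 _ _ hW) hxn))
  · have hx2 := hq x rfl
    have he2 : nb G Z2 \ A ⊆ nb G Z' \ insert x A := by
      rintro t ⟨ht, hA⟩
      refine ⟨nb_mono hs ht, ?_⟩
      rintro (rfl | h)
      · exact hx2 ht
      · exact hA h
    have := H Z2 h' ⟨fun z hz => hB z (hs hz), hM _ he2 sdiff_subset, W'.noray.mono he2⟩ (hu z hz hz')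
    exact hz' (image_mono he2 this)

/-- domination lemma -/
lemma dominate {G : V → V → Prop} {A B : Set V} (H : Unh G A B) {u : V}
    (hu : ¬ Unh G (insert u A) B) : ∃ Z h, Wave G A B Z h ∧ u ∈ nb G Z := by
  unfold Unh at hu
  push Not at hu
  obtain ⟨Z', h', W', hz⟩ := hu
  obtain ⟨z, hz, hz'⟩ := not_subset.1 hz
  have huA : u ∉ A := by
    intro h
    rw [insert_eq_of_mem h] at W' hz'
    exact hz' (H _ _ W' hz)
  by_cases hxn : u ∈ nb G Z'
  swap
  · have he : nb G Z' \ insert u A = nb G Z' \ A := by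
      ext t
      simp only [mem_sdiff, mem_insert_iff, not_or, and_congr_right_iff, and_iff_right_iff_imp]
      rintro ht _ rfl
      exact hxn ht
    have := H Z' h' ⟨W'.disj, he ▸ W'.mt, he ▸ W'.noray⟩ hz
    rw [← he] at this
    exact (hz' this).elim
  have he : insert u (nb G Z' \ insert u A) = nb G Z' \ A := by
    ext t
    simp only [mem_sdiff, mem_insert_iff, not_or]
    constructor
    · rintro (rfl | h)
      · exact ⟨hxn, huA⟩
      · exact ⟨h.1, h.2.2⟩
    · intro h
      by_cases e : t = u
      · exact Or.inl e
      · exact Or.inr ⟨h.1, e, h.2⟩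
  rcases core W'.mt (Q0 := {u}) (by simp) with ⟨q0, hq0, z0, hz0, hz0', h2, hf, hM, him⟩ | ⟨Z2, hs, hu, hq, hM⟩
  · obtain rfl : q0 = u := hq0
    rw [he] at hM
    have hW : Wave G A B Z' h2 := ⟨W'.disj, hM, W'.noray.finite_change hf (by
      rw [← he]; refine (finite_singleton q0).subset ?_; rintro t ⟨h1 | h1, h2⟩
      · exact h1
      · exact (h2 h1).elim)⟩
    exact ⟨_, _, hW, hxn⟩
  · have hx2 := hq u rfl
    have he2 : nb G Z2 \ A ⊆ nb G Z' \ insert u A := by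
      rintro t ⟨ht, hA⟩
      refine ⟨nb_mono hs ht, ?_⟩
      rintro (rfl | h)
      · exact hx2 ht
      · exact hA h
    have := H Z2 h' ⟨fun z hz => W'.disj z (hs hz), hM _ he2 sdiff_subset, W'.noray.mono he2⟩ (hu z hz hz')
    exact (hz' (image_mono he2 this)).elim

/-- w3 -/
lemma unh_delete {G : V → V → Prop} {A B : Set V} {x : V} (hxA : x ∉ A)
    (H : Unh G (insert x A) (insert x B)) : Unh G A B := by
  by_contra hc
  unfold Unh at hc
  push Not at hc
  obtain ⟨Z, h, W, hz⟩ := hc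
  obtain ⟨z, hz, hz'⟩ := not_subset.1 hz
  by_cases hxZ : x ∈ Z
  swap
  · have hs : nb G Z \ insert x A ⊆ nb G Z \ A := fun t ht => ⟨ht.1, fun h => ht.2 (Or.inr h)⟩
    have := H Z h ⟨fun w hw hb => hb.elim (fun e => hxZ (e ▸ hw)) (W.disj w hw), W.mt.mono hs,
      W.noray.mono hs⟩ hz
    exact hz' (image_mono hs this)
  let Z1 := Z \ {x}
  have hZ1 : Z1 ⊆ Z := sdiff_subset
  let D1 := nb G Z1 \ insert x A
  have hD1 : D1 ⊆ nb G Z \ A := fun t ht => ⟨nb_mono hZ1 ht.1, fun h => ht.2 (Or.inr h)⟩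
  have hB1 : ∀ w ∈ Z1, w ∉ insert x B := by
    rintro w hw (rfl | hb)
    · exact hw.2 rfl
    · exact W.disj w hw.1 hb
  have hxD : x ∈ nb G Z \ A := ⟨subset_nb hxZ, hxA⟩
  -- h x not hit by D1
  have hxx : h x ∉ h '' D1 := by
    rintro ⟨t, ht, he⟩
    exact ht.2 (Or.inl (W.mt.inj (hD1 ht) hxD he))
  have hzD : z ∉ h '' D1 := fun hh => hz' (image_mono hD1 hh)
  by_cases ht0 : ∃ t0 ∈ D1, h t0 = x
  · obtain ⟨t0, ht0, hx0⟩ := ht0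
    have hzx : z ≠ x := fun e => hz' ⟨t0, hD1 ht0, hx0.trans e.symm⟩
    have hyx : h x ≠ x := fun e => hxx ⟨t0, ht0, hx0.trans e.symm⟩
    have hzy : z ≠ h x := fun e => hz' ⟨x, hxD, e.symm⟩
    have hD0 : D1 \ {t0} ⊆ nb G Z \ A := sdiff_subset.trans hD1
    have hM0 : Mt G (D1 \ {t0}) Z1 h := ⟨fun t ht => ⟨W.mt.maps t (hD0 ht), fun e =>
      ht.2 (W.mt.inj (hD0 ht) (hD1 ht0) ((mem_singleton_iff.1 e).trans hx0.symm))⟩,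
      fun t ht => W.mt.rel t (hD0 ht), W.mt.inj.mono hD0⟩
    have e0 : insert t0 (D1 \ {t0}) = D1 := by rw [insert_sdiff_singleton, insert_eq_of_mem ht0]
    rcases core hM0 (Q0 := {t0}) (by simp) with ⟨q0, hq0, z0, hz0, hz0', h2, hf, hM, him⟩ | ⟨Z2, hs, hu, hq, hM⟩
    · obtain rfl : q0 = t0 := hq0
      rw [e0] at hM him
      have := H Z1 h2 ⟨hB1, hM, (W.noray.mono hD1).finite_change hf (by simp [D1])⟩
      have a1 := this ⟨hz, hzx⟩
      have a2 := this (⟨W.mt.maps x hxD, hyx⟩ : h x ∈ Z1)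
      change z ∈ h2 '' D1 at a1
      change h x ∈ h2 '' D1 at a2
      rw [him] at a1 a2
      have b1 : z = z0 := a1.resolve_right (fun hh => hzD (image_mono sdiff_subset hh))
      have b2 : h x = z0 := a2.resolve_right (fun hh => hxx (image_mono sdiff_subset hh))
      exact hzy (b1.trans b2.symm)
    · have ht2 := hq t0 rfl
      have he2 : nb G Z2 \ insert x A ⊆ D1 \ {t0} := fun t ht =>
        ⟨⟨nb_mono hs ht.1, ht.2⟩, fun e => ht2 ((mem_singleton_iff.1 e) ▸ ht.1)⟩
      have := H Z2 h ⟨fun w hw => hB1 w (hs hw), hM _ he2 sdiff_subset, W.noray.mono (he2.trans hD0)⟩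
        (hu z ⟨hz, hzx⟩ (fun hh => hzD (image_mono sdiff_subset hh)))
      exact hzD (image_mono (he2.trans sdiff_subset) this)
  · push Not at ht0
    have hM : Mt G D1 Z1 h := ⟨fun t ht => ⟨W.mt.maps t (hD1 ht), ht0 t ht⟩,
      fun t ht => W.mt.rel t (hD1 ht), W.mt.inj.mono hD1⟩
    have := H Z1 h ⟨hB1, hM, W.noray.mono hD1⟩
    by_cases hzx : z = x
    · have hyx : h x ≠ x := fun e => hz' ⟨x, hxD, e.trans hzx.symm⟩
      exact hxx (this ⟨W.mt.maps x hxD, hyx⟩)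
    · exact hzD (this ⟨hz, hzx⟩)

end Flm

namespace Flm
open Set

structure Link (G : V → V → Prop) (A B : Set V) (p : V → ℕ → V) (n : V → ℕ) : Prop where
  start : ∀ a ∈ A, p a 0 = a
  step : ∀ a ∈ A, ∀ m, m < n a → G (p a m) (p a (m + 1))
  fin : ∀ a ∈ A, p a (n a) ∈ B
  inj : ∀ a ∈ A, ∀ a' ∈ A, ∀ m m', m ≤ n a → m' ≤ n a' → p a m = p a' m' → a = a' ∧ m = m'

lemma unh_delete_finite {G : V → V → Prop} {Y : Set V} (hY : Y.Finite) :
    ∀ {A B : Set V}, (∀ y ∈ Y, y ∉ A) → Unh G (A ∪ Y) (B ∪ Y) → Unh G A B := by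
  induction Y, hY using Set.Finite.induction_on with
  | empty => intro A B _ h; simpa using h
  | @insert y Y hy _ ih =>
    intro A B hA h
    refine unh_delete (x := y) (hA y (mem_insert _ _)) (ih (A := insert y A) (B := insert y B) ?_ ?_)
    · rintro z hz (rfl | h)
      · exact hy hz
      · exact hA z (mem_insert_of_mem _ hz) h
    · rwa [insert_union, insert_union, ← union_insert, ← union_insert]

def PathIn (G : V → V → Prop) (a : V) (X : Set V) (b : V) : Prop :=
  ∃ (n : ℕ) (f : ℕ → V), f 0 = a ∧ (∀ m, m < n → G (f m) (f (m + 1))) ∧ f n = b ∧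
    InjOn f (Iic n) ∧ ∀ m, m ≤ n → f m ∈ X

lemma PathIn.mono {G : V → V → Prop} {a b : V} {X X' : Set V} (H : PathIn G a X b) (h : X ⊆ X') :
    PathIn G a X' b := by
  obtain ⟨n, f, h1, h2, h3, h4, h5⟩ := H
  exact ⟨n, f, h1, h2, h3, h4, fun m hm => h (h5 m hm)⟩

lemma PathIn.extend {G : V → V → Prop} {a b x : V} {X : Set V} (H : PathIn G a X b) (hx : x ∉ X)
    (hG : G b x) : PathIn G a (insert x X) x := by
  obtain ⟨n, f, h1, h2, h3, h4, h5⟩ := H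
  refine ⟨n + 1, fun m => if m ≤ n then f m else x, by simp [h1], ?_, by simp, ?_, ?_⟩
  · intro m hm
    by_cases hm' : m + 1 ≤ n
    · simp only [hm', if_true, show m ≤ n by omega]
      exact h2 m (by omega)
    · obtain rfl : m = n := by omega
      simp [h3, hG]
  · intro i hi j hj he
    simp only [mem_Iic] at hi hj
    by_cases hi' : i ≤ n <;> by_cases hj' : j ≤ n <;> simp only [hi', hj', if_true, if_false] at he
    · exact h4 hi' hj' he
    · exact (hx (he ▸ h5 i hi')).elim
    · exact (hx (he ▸ h5 j hj')).elim
    · omega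
  · intro m hm
    by_cases hm' : m ≤ n
    · simp only [hm', if_true]; exact Or.inr (h5 m hm')
    · simp [hm']

lemma lemmaM [Countable V] {G : V → V → Prop} {A B : Set V} (H : Unh G A B) {a : V} (ha : a ∈ A) :
    ∃ (n : ℕ) (f : ℕ → V), f 0 = a ∧ (∀ m, m < n → G (f m) (f (m + 1))) ∧ f n ∈ B ∧
    InjOn f (Iic n) ∧ (∀ m, 0 < m → m ≤ n → f m ∉ A) ∧
    Unh G (A ∪ f '' Iic n) (B ∪ f '' Iic n) := by
  classical
  have : Nonempty V := ⟨a⟩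
  obtain ⟨en, hen⟩ := exists_surjective_nat V
  choose zz hz hzz using fun X : Set V => exists_gwave G (A ∪ X) (B ∪ X)
  let cond : Set V → V → Prop := fun X x => x ∉ nb G (zz X) ∪ (A ∪ X) ∧ ∃ x' ∈ X, G x' x
  let X : ℕ → Set V := fun n => Nat.rec (motive := fun _ => Set V) {a} (fun n X =>
    if cond X (en n.unpair.1) then insert (en n.unpair.1) X else X) n
  have X0 : X 0 = {a} := rfl
  have Xs : ∀ n : ℕ, X (n + 1) = if cond (X n) (en n.unpair.1) then insert (en n.unpair.1) (X n) else X n :=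
    fun n => rfl
  have inv : ∀ n, a ∈ X n ∧ (X n).Finite ∧ (∀ x ∈ X n, x ∈ A → x = a) ∧
      (∀ x ∈ X n, PathIn G a (X n) x) ∧ Unh G (A ∪ X n) (B ∪ X n) := by
    intro n
    induction n with
    | zero =>
      rw [X0]
      refine ⟨rfl, finite_singleton _, fun x hx _ => hx, ?_, ?_⟩
      · rintro x rfl
        exact ⟨0, fun _ => x, rfl, by simp, rfl, by intro i hi j hj _; simp at hi hj; omega, by simp⟩
      · have : A ∪ {a} = A := by simp [ha]
        rw [this]
        exact H.monoB subset_union_left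
    | succ n ih =>
      obtain ⟨i1, i2, i3, i4, i5⟩ := ih
      rw [Xs]
      split_ifs with hc
      · obtain ⟨hc1, x', hx', hG⟩ := hc
        set x := en n.unpair.1
        refine ⟨Or.inr i1, i2.insert _, ?_, ?_, ?_⟩
        · rintro y (rfl | hy) hA
          · exact (hc1 (Or.inr (Or.inl hA))).elim
          · exact i3 y hy hA
        · rintro y (rfl | hy)
          · exact (i4 x' hx').extend (fun h => hc1 (Or.inr (Or.inr h))) hG
          · exact (i4 y hy).mono (subset_insert _ _)
        · have := unh_insert i5 (hzz (X n)) hc1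
          rwa [union_insert, union_insert]
      · exact ⟨i1, i2, i3, i4, i5⟩
  have Xmono : Monotone X := monotone_nat_of_le_succ (fun n => by
    rw [Xs]; split_ifs
    · exact subset_insert _ _
    · exact le_rfl)
  by_cases hmeet : ∃ n, ∃ b ∈ X n, b ∈ B
  · obtain ⟨k, b, hbX, hbB⟩ := hmeet
    obtain ⟨i1, i2, i3, i4, i5⟩ := inv k
    obtain ⟨n, f, h1, h2, h3, h4, h5⟩ := i4 b hbX
    have hsub : f '' Iic n ⊆ X k := by rintro _ ⟨m, hm, rfl⟩; exact h5 m hm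
    refine ⟨n, f, h1, h2, h3 ▸ hbB, h4, ?_, ?_⟩
    · intro m hm hmn hA
      have := i3 _ (h5 m hmn) hA
      have := h4 (show m ∈ Iic n from hmn) (show 0 ∈ Iic n by simp) (this.trans h1.symm)
      omega
    · have e : ∀ C : Set V, (C ∪ f '' Iic n) ∪ (X k \ f '' Iic n) = C ∪ X k := by
        intro C; rw [union_assoc, union_sdiff_cancel hsub]
      refine unh_delete_finite (Y := X k \ f '' Iic n) (i2.subset sdiff_subset) ?_ (by rw [e, e]; exact i5)
      rintro y ⟨hy, hy'⟩ (hA | h)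
      · exact hy' ⟨0, by simp, h1.trans (i3 y hy hA).symm⟩
      · exact hy' h
  · exfalso
    push Not at hmeet
    let XX := ⋃ n, X n
    have zwave : ∀ k n, Wave G (A ∪ X (n + k)) (B ∪ X (n + k)) (zz (X n)) (hz (X n)) := by
      intro k n
      induction k with
      | zero => exact (hzz (X n)).1
      | succ k ih =>
        have hs : zz (X n) ⊆ zz (X (n + k)) := (hzz (X (n + k))).2 _ _ ih
        rw [← add_assoc, Xs]
        split_ifs with hc
        · set x := en (n + k).unpair.1
          have hsub : nb G (zz (X n)) \ (A ∪ insert x (X (n + k))) ⊆ nb G (zz (X n)) \ (A ∪ X (n + k)) :=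
            sdiff_subset_sdiff_right (union_subset_union_right _ (subset_insert _ _))
          refine ⟨?_, ih.mt.mono hsub, ih.noray.mono hsub⟩
          rintro z hz (hb | rfl | hb)
          · exact ih.disj z hz (Or.inl hb)
          · exact hc.1 (Or.inl (subset_nb (hs hz)))
          · exact ih.disj z hz (Or.inr hb)
        · exact ih
    have zwaveX : ∀ n, Wave G (A ∪ XX) (B ∪ XX) (zz (X n)) (hz (X n)) := by
      intro n
      have hsub : nb G (zz (X n)) \ (A ∪ XX) ⊆ nb G (zz (X n)) \ (A ∪ X n) :=
        sdiff_subset_sdiff_right (union_subset_union_right _ (subset_iUnion _ _))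
      refine ⟨?_, (zwave 0 n).mt.mono hsub, (zwave 0 n).noray.mono hsub⟩
      rintro z hz (hb | hx)
      · exact (zwave 0 n).disj z hz (Or.inl hb)
      · obtain ⟨m, hm⟩ := mem_iUnion.1 hx
        exact (zwave m n).disj z hz (Or.inr (Xmono (by omega) hm))
    obtain ⟨Z, h, W⟩ := exists_gwave G (A ∪ XX) (B ∪ XX)
    have haX : a ∈ XX := mem_iUnion.2 ⟨0, rfl⟩
    have hdisj : ∀ z ∈ Z, z ∉ XX := fun z hz hx => W.1.disj z hz (Or.inr hx)
    have key : ∀ t ∈ nb G (Z ∪ XX), t ∉ A → t ∉ XX → t ∈ nb G Z \ (A ∪ XX) := by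
      intro t ht hA hX
      have hAX : t ∉ A ∪ XX := by rintro (h | h); exacts [hA h, hX h]
      rw [nb_union] at ht
      rcases ht with ht | ht
      · exact ⟨ht, hAX⟩
      · rcases ht with ht | ⟨x', hx', hG⟩
        · exact (hX ht).elim
        · obtain ⟨m, hm⟩ := mem_iUnion.1 hx'
          obtain ⟨i, hi⟩ := hen t
          let n := Nat.pair i m
          have hn : m ≤ n := Nat.right_le_pair i m
          have ht' : en n.unpair.1 = t := by simp [n, hi]
          have hc : ¬ cond (X n) t := by
            intro hc
            apply hX
            refine mem_iUnion.2 ⟨n + 1, ?_⟩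
            rw [Xs, ht', if_pos hc]
            exact mem_insert _ _
          have : t ∈ nb G (zz (X n)) ∪ (A ∪ X n) := by
            by_contra h'
            exact hc ⟨h', x', Xmono hn hm, hG⟩
          rcases this with h1 | h1 | h1
          · exact ⟨nb_mono (W.2 _ _ (zwaveX n)) h1, hAX⟩
          · exact (hA h1).elim
          · exact (hX (mem_iUnion.2 ⟨n, h1⟩)).elim
    let h' : V → V := fun t => if t ∈ XX then t else h t
    have e1 : ∀ t ∈ XX, h' t = t := fun t ht => if_pos ht
    have e2 : ∀ t ∉ XX, h' t = h t := fun t ht => if_neg ht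
    have W' : Wave G A B (Z ∪ XX) h' := by
      refine ⟨?_, ⟨?_, ?_, ?_⟩, ?_⟩
      · rintro z (hz | hz) hb
        · exact W.1.disj z hz (Or.inl hb)
        · obtain ⟨m, hm⟩ := mem_iUnion.1 hz
          exact hmeet m z hm hb
      · rintro t ⟨ht, hA⟩
        by_cases hX : t ∈ XX
        · rw [e1 t hX]; exact Or.inr hX
        · rw [e2 t hX]; exact Or.inl (W.1.mt.maps t (key t ht hA hX))
      · rintro t ⟨ht, hA⟩
        by_cases hX : t ∈ XX
        · rw [e1 t hX]; exact Or.inl rfl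
        · rw [e2 t hX]; exact (W.1.mt.rel t (key t ht hA hX))
      · rintro t ⟨ht, hA⟩ t' ⟨ht', hA'⟩ he
        by_cases hX : t ∈ XX <;> by_cases hX' : t' ∈ XX
        · rwa [e1 t hX, e1 t' hX'] at he
        · rw [e1 t hX, e2 t' hX'] at he
          exact (hdisj _ (W.1.mt.maps t' (key t' ht' hA' hX')) (he ▸ hX)).elim
        · rw [e2 t hX, e1 t' hX'] at he
          exact (hdisj _ (W.1.mt.maps t (key t ht hA hX)) (he ▸ hX')).elim
        · rw [e2 t hX, e2 t' hX'] at he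
          exact W.1.mt.inj (key t ht hA hX) (key t' ht' hA' hX') he
      · rintro ⟨q, hq, h3⟩
        have hn : ∀ n, q n ∉ XX := by
          intro n hX
          have := (h3 n).2
          rw [e1 _ hX] at this
          have := hq this
          omega
        refine W.1.noray ⟨q, hq, fun n => ⟨key _ (h3 n).1.1 (h3 n).1.2 (hn n), ?_⟩⟩
        rw [← e2 _ (hn n)]; exact (h3 n).2
    obtain ⟨t, ⟨ht, hA⟩, hta⟩ := H _ _ W' (Or.inr haX : a ∈ Z ∪ XX)
    by_cases hX : t ∈ XX
    · rw [e1 t hX] at hta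
      exact hA (hta ▸ ha)
    · rw [e2 t hX] at hta
      exact hdisj _ (W.1.mt.maps t (key t ht hA hX)) (hta ▸ haX)

theorem menger [Countable V] {G : V → V → Prop} {A B : Set V} (H : Unh G A B) :
    ∃ p n, Link G A B p n := by
  classical
  by_cases hV : Nonempty V
  swap
  · exact ⟨fun v _ => v, fun _ => 0, ⟨fun a => (hV ⟨a⟩).elim, fun a => (hV ⟨a⟩).elim,
      fun a => (hV ⟨a⟩).elim, fun a => (hV ⟨a⟩).elim⟩⟩
  obtain ⟨en, hen⟩ := exists_surjective_nat V
  have hM : ∀ (X : Set V) (a : V), ∃ nf : ℕ × (ℕ → V), Unh G (A ∪ X) (B ∪ X) → a ∈ A →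
      nf.2 0 = a ∧ (∀ m, m < nf.1 → G (nf.2 m) (nf.2 (m + 1))) ∧ nf.2 nf.1 ∈ B ∪ X ∧
    InjOn nf.2 (Iic nf.1) ∧ (∀ m, 0 < m → m ≤ nf.1 → nf.2 m ∉ A ∪ X) ∧
    Unh G (A ∪ X ∪ nf.2 '' Iic nf.1) (B ∪ X ∪ nf.2 '' Iic nf.1) := by
    intro X a
    by_cases hu : Unh G (A ∪ X) (B ∪ X) ∧ a ∈ A
    · obtain ⟨n, f, h⟩ := lemmaM hu.1 (a := a) (Or.inl hu.2)
      exact ⟨(n, f), fun _ _ => h⟩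
    · exact ⟨(0, fun _ => a), fun h h' => (hu ⟨h, h'⟩).elim⟩
  choose nf hnf using hM
  let P : Set V → V → Set V := fun X a => (nf X a).2 '' Iic (nf X a).1
  let X : ℕ → Set V := fun n => Nat.rec (motive := fun _ => Set V) ∅ (fun n X =>
    if en n ∈ A ∧ en n ∉ X then X ∪ P X (en n) else X) n
  have X0 : X 0 = ∅ := rfl
  have Xs : ∀ n : ℕ, X (n + 1) = if en n ∈ A ∧ en n ∉ X n then X n ∪ P (X n) (en n) else X n := fun n => rfl
  have Xu : ∀ n, Unh G (A ∪ X n) (B ∪ X n) := by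
    intro n
    induction n with
    | zero => rw [X0]; simpa using H
    | succ n ih =>
      rw [Xs]
      split_ifs with hc
      · rw [← union_assoc, ← union_assoc]; exact (hnf (X n) (en n) ih hc.1).2.2.2.2.2
      · exact ih
  have Xmono : Monotone X := monotone_nat_of_le_succ (fun n => by
    rw [Xs]; split_ifs
    · exact subset_union_left
    · exact le_rfl)
  have hex : ∀ a ∈ A, ∃ k, a ∈ X (k + 1) := by
    intro a ha
    obtain ⟨k, rfl⟩ := hen a
    refine ⟨k, ?_⟩
    rw [Xs]
    split_ifs with hc
    · refine Or.inr ⟨0, by simp, (hnf (X k) (en k) (Xu k) ha).1⟩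
    · push Not at hc
      exact hc ha
  have hst : ∀ a ∈ A, ∃ k, en k = a ∧ a ∉ X k ∧ P (X k) a ⊆ X (k + 1) := by
    intro a ha
    let k := Nat.find (hex a ha)
    have h1 : a ∈ X (k + 1) := Nat.find_spec (hex a ha)
    have h2 : a ∉ X k := by
      rcases hk : k with _ | j
      · simp [X0]
      · intro h
        have := Nat.find_min' (hex a ha) h
        change k ≤ j at this
        omega
    rw [Xs] at h1
    split_ifs at h1 with hc
    · rcases h1 with h1 | ⟨m, hm, h1⟩
      · exact (h2 h1).elim
      · have hh := hnf (X k) (en k) (Xu k) hc.1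
        have hm0 : m = 0 := by
          by_contra hm0
          exact hh.2.2.2.2.1 m (by omega) hm (Or.inl (h1 ▸ ha))
        subst hm0
        rw [hh.1] at h1
        refine ⟨k, h1, h2, ?_⟩
        rw [Xs, if_pos hc, h1]
        exact subset_union_right
    · exact (h2 h1).elim
  choose! κ hκ1 hκ2 hκ3 using hst
  have hh := fun a (ha : a ∈ A) => hnf (X (κ a)) a (Xu _) ha
  have avoid : ∀ a ∈ A, ∀ m, m ≤ (nf (X (κ a)) a).1 → (nf (X (κ a)) a).2 m ∉ X (κ a) := by
    intro a ha m hm hx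
    rcases Nat.eq_zero_or_pos m with rfl | h0
    · rw [(hh a ha).1] at hx
      exact hκ2 a ha hx
    · exact (hh a ha).2.2.2.2.1 m h0 hm (Or.inr hx)
  have lt_case : ∀ a ∈ A, ∀ a' ∈ A, ∀ m m', m ≤ (nf (X (κ a)) a).1 → m' ≤ (nf (X (κ a')) a').1 →
      (nf (X (κ a)) a).2 m = (nf (X (κ a')) a').2 m' → ¬ κ a < κ a' := by
    intro a ha a' ha' m m' hm hm' he hlt
    refine avoid a' ha' m' hm' ?_
    rw [← he]
    exact Xmono (show κ a + 1 ≤ κ a' from hlt) (hκ3 a ha ⟨m, hm, rfl⟩)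
  refine ⟨fun a => (nf (X (κ a)) a).2, fun a => (nf (X (κ a)) a).1, fun a ha => (hh a ha).1,
    fun a ha => (hh a ha).2.1, fun a ha => ?_, ?_⟩
  · exact (hh a ha).2.2.1.resolve_right (avoid a ha _ le_rfl)
  · intro a ha a' ha' m m' hm hm' he
    have h1 := lt_case a ha a' ha' m m' hm hm' he
    have h2 := lt_case a' ha' a ha m' m hm' hm he.symm
    have h3 : κ a = κ a' := by omega
    have h4 : a = a' := by rw [← hκ1 a ha, ← hκ1 a' ha', h3]
    subst h4
    exact ⟨rfl, (hh a ha).2.2.2.1 hm hm' he⟩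

end Flm

namespace Flm
open Set

lemma Wave.h_mem {G : V → V → Prop} {A B Z : Set V} {h : V → V} (W : Wave G A B Z h) {x : V}
    (hx : x ∈ nb G Z \ A) : h x ∈ Z := W.mt.maps x hx

lemma orbit_unique {h : V → V} {D : Set V} (hi : InjOn h D) {x y : V} (hx : x ∉ h '' D)
    (hy : y ∉ h '' D) : ∀ (n m : ℕ), (∀ k, k < n → h^[k] x ∈ D) → (∀ k, k < m → h^[k] y ∈ D) →
    h^[n] x = h^[m] y → x = y ∧ n = m := by
  intro n
  induction n with
  | zero =>
    intro m hn hm he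
    rcases m with _ | m
    · exact ⟨he, rfl⟩
    · rw [Function.iterate_succ_apply'] at he
      exact (hx ⟨_, hm m (by omega), he.symm⟩).elim
  | succ n ih =>
    intro m hn hm he
    rcases m with _ | m
    · rw [Function.iterate_succ_apply'] at he
      exact (hy ⟨_, hn n (by omega), he⟩).elim
    · rw [Function.iterate_succ_apply', Function.iterate_succ_apply'] at he
      have := ih m (fun k hk => hn k (by omega)) (fun k hk => hm k (by omega))
        (hi (hn n (by omega)) (hm m (by omega)) he)
      exact ⟨this.1, by omega⟩

lemma endpoint {G : V → V → Prop} {A B Z : Set V} {h : V → V} (W : Wave G A B Z h) {x : V}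
    (hx : x ∈ nb G Z ∪ A) (hx' : x ∉ h '' (nb G Z \ A)) :
    ∃ n, h^[n] x ∈ A ∧ ∀ m, m < n → h^[m] x ∈ nb G Z \ A := by
  classical
  by_cases hex : ∃ n, h^[n] x ∈ A
  · refine ⟨Nat.find hex, Nat.find_spec hex, ?_⟩
    intro m
    induction m with
    | zero => intro hm; exact ⟨hx.resolve_right (Nat.find_min hex hm), Nat.find_min hex hm⟩
    | succ m ih =>
      intro hm
      refine ⟨?_, Nat.find_min hex hm⟩
      rw [Function.iterate_succ_apply']
      exact subset_nb (W.mt.maps _ (ih (by omega)))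
  · exfalso
    push Not at hex
    have hall : ∀ m, h^[m] x ∈ nb G Z \ A := by
      intro m
      induction m with
      | zero => exact ⟨hx.resolve_right (hex 0), hex 0⟩
      | succ m ih =>
        refine ⟨?_, hex _⟩
        rw [Function.iterate_succ_apply']
        exact subset_nb (W.mt.maps _ ih)
    refine W.noray ⟨fun m => h^[m] x, ?_, fun m => ⟨hall m, (Function.iterate_succ_apply' h m x).symm⟩⟩
    intro m m' he
    exact (orbit_unique W.mt.inj hx' hx' m m' (fun k _ => hall k) (fun k _ => hall k) he).2

lemma endpoints {G : V → V → Prop} {A B Z : Set V} {h : V → V} (W : Wave G A B Z h) :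
    ∃ e : V → V, InjOn e {x | x ∈ nb G Z ∪ A ∧ x ∉ h '' (nb G Z \ A)} ∧
      ∀ x, x ∈ nb G Z ∪ A → x ∉ h '' (nb G Z \ A) → e x ∈ A := by
  have : ∀ x, ∃ n, x ∈ nb G Z ∪ A → x ∉ h '' (nb G Z \ A) →
      h^[n] x ∈ A ∧ ∀ m, m < n → h^[m] x ∈ nb G Z \ A := by
    intro x
    by_cases hx : x ∈ nb G Z ∪ A ∧ x ∉ h '' (nb G Z \ A)
    · obtain ⟨n, hn⟩ := endpoint W hx.1 hx.2
      exact ⟨n, fun _ _ => hn⟩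
    · exact ⟨0, fun a b => (hx ⟨a, b⟩).elim⟩
  choose n hn using this
  refine ⟨fun x => h^[n x] x, ?_, fun x h1 h2 => (hn x h1 h2).1⟩
  rintro x ⟨h1, h2⟩ y ⟨h3, h4⟩ he
  exact (orbit_unique W.mt.inj h2 h4 _ _ (hn x h1 h2).2 (hn y h3 h4).2 he).1

lemma first_exit {G : V → V → Prop} {A B Z T : Set V} {p n} (L : Link G A B p n) (hA : A ⊆ T)
    (hT : nb G Z ⊆ T) (hB : ∀ z ∈ Z, z ∉ B) : ∃ s : V → V, InjOn s A ∧ ∀ a ∈ A, s a ∈ T ∧ s a ∉ Z := by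
  classical
  have : ∀ a, ∃ m, a ∈ A → m ≤ n a ∧ p a m ∈ T ∧ p a m ∉ Z := by
    intro a
    by_cases ha : a ∈ A
    swap
    · exact ⟨0, fun h => (ha h).elim⟩
    have hex : ∃ m, p a m ∉ Z := ⟨n a, fun hz => hB _ hz (L.fin a ha)⟩
    refine ⟨Nat.find hex, fun _ => ?_⟩
    have hle : Nat.find hex ≤ n a := Nat.find_min' hex (fun hz => hB _ hz (L.fin a ha))
    refine ⟨hle, ?_, Nat.find_spec hex⟩
    rcases hk : Nat.find hex with _ | k
    · rw [L.start a ha]; exact hA ha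
    · refine hT (Or.inr ⟨p a k, ?_, L.step a ha k (by omega)⟩)
      have := Nat.find_min hex (m := k) (by omega)
      exact not_not.1 this
  choose m hm using this
  refine ⟨fun a => p a (m a), ?_, fun a ha => (hm a ha).2⟩
  intro a ha a' ha' he
  exact (L.inj a ha a' ha' _ _ (hm a ha).1 (hm a' ha').1 he).1

lemma Wave.bdry_not_range {G : V → V → Prop} {A B Z : Set V} {h : V → V} (W : Wave G A B Z h)
    {x : V} (hx : x ∉ Z) : x ∉ h '' (nb G Z \ A) := by
  rintro ⟨t, ht, rfl⟩
  exact hx (W.mt.maps t ht)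

lemma Wave.bdry_finite {G : V → V → Prop} {A B Z : Set V} {h : V → V} (W : Wave G A B Z h)
    (hA : A.Finite) : ((nb G Z ∪ A) \ Z).Finite := by
  obtain ⟨e, he, hm⟩ := endpoints W
  refine Finite.of_injOn (f := e) (t := A) ?_ (he.mono ?_) hA
  · intro x hx; exact hm x hx.1 (W.bdry_not_range hx.2)
  · intro x hx; exact ⟨hx.1, W.bdry_not_range hx.2⟩

/-- the finite lemma -/
lemma link_unh {G : V → V → Prop} {A B : Set V} {p n} (hA : A.Finite) (L : Link G A B p n) :
    Unh G A B := by
  intro Z h W z hz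
  by_contra hz'
  obtain ⟨s, hs, hsm⟩ := first_exit L (T := nb G Z ∪ A) subset_union_right subset_union_left W.disj
  obtain ⟨e, he, hm⟩ := endpoints W
  have hsub : insert z (s '' A) ⊆ {x | x ∈ nb G Z ∪ A ∧ x ∉ h '' (nb G Z \ A)} := by
    rintro _ (rfl | ⟨a, ha, rfl⟩)
    · exact ⟨Or.inl (subset_nb hz), hz'⟩
    · exact ⟨(hsm a ha).1, W.bdry_not_range (hsm a ha).2⟩
  have h1 : (insert z (s '' A)).ncard ≤ A.ncard := by
    refine ncard_le_ncard_of_injOn e (fun x hx => hm x (hsub hx).1 (hsub hx).2) (he.mono hsub) hA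
  rw [ncard_insert_of_notMem _ (hA.image s), ncard_image_of_injOn hs] at h1
  · omega
  · rintro ⟨a, ha, rfl⟩
    exact (hsm a ha).2 hz

lemma Link.mono {G G' : V → V → Prop} {A A' B B' : Set V} {p n} (L : Link G A B p n)
    (hG : ∀ x y, G x y → G' x y) (hA : A' ⊆ A) (hB : B ⊆ B') : Link G' A' B' p n :=
  ⟨fun a ha => L.start a (hA ha), fun a ha m hm => hG _ _ (L.step a (hA ha) m hm),
    fun a ha => hB (L.fin a (hA ha)), fun a ha a' ha' => L.inj a (hA ha) a' (hA ha')⟩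

/-- swap invariant -/
structure SwInv (G : V → V → Prop) (A B Z K I : Set V) (h : V → V) : Prop where
  K_sub : K ⊆ I
  I_sub : I ⊆ A
  A_sub : A ⊆ nb G Z ∪ I
  wave : Wave G I B Z h
  sat : Z ⊆ h '' (nb G Z \ I)
  noback : NoBack h (nb G Z \ I)

lemma swap_init {G : V → V → Prop} {A A0 B Z : Set V} {h : V → V} (W : Wave G A B Z h)
    (hA0 : A0 ⊆ A) (hAB : A0 ⊆ B) : ∃ I h', SwInv G A B Z A0 I h' := by
  classical
  let D := nb G Z \ A
  let S := (nb G Z ∪ A) \ Z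
  let O : Set V := {t | ∃ s ∈ S, ∃ n, (∀ m, m < n → h^[m] s ∈ D) ∧ h^[n] s = t}
  have SO : S ⊆ O := fun s hs => ⟨s, hs, 0, by simp, rfl⟩
  have Ostep : ∀ t ∈ O, t ∈ D → h t ∈ O := by
    rintro t ⟨s, hs, n, hn, rfl⟩ ht
    refine ⟨s, hs, n + 1, ?_, Function.iterate_succ_apply' _ _ _⟩
    intro m hm
    rcases Nat.lt_succ_iff_lt_or_eq.1 hm with h1 | rfl
    · exact hn m h1
    · exact ht
  let I := A ∩ O
  let h' : V → V := fun t => if t ∈ O then h t else t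
  have e1 : ∀ t ∈ O, h' t = h t := fun t ht => if_pos ht
  have e2 : ∀ t ∉ O, h' t = t := fun t ht => if_neg ht
  have kO : ∀ t ∈ nb G Z \ I, t ∈ O → t ∈ D := fun t ht hO => ⟨ht.1, fun hA => ht.2 ⟨hA, hO⟩⟩
  have kZ : ∀ t ∈ nb G Z \ I, t ∉ O → t ∈ Z := by
    intro t ht hO
    by_contra hZ
    exact hO (SO ⟨Or.inl ht.1, hZ⟩)
  refine ⟨I, h', ?_, inter_subset_left, ?_, ⟨W.disj, ⟨?_, ?_, ?_⟩, ?_⟩, ?_, ?_⟩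
  · intro a ha
    exact ⟨hA0 ha, SO ⟨Or.inr (hA0 ha), fun hz => W.disj a hz (hAB ha)⟩⟩
  · intro a ha
    by_cases hz : a ∈ Z
    · exact Or.inl (subset_nb hz)
    · exact Or.inr ⟨ha, SO ⟨Or.inr ha, hz⟩⟩
  · intro t ht
    by_cases hO : t ∈ O
    · rw [e1 t hO]; exact W.mt.maps t (kO t ht hO)
    · rw [e2 t hO]; exact kZ t ht hO
  · intro t ht
    by_cases hO : t ∈ O
    · rw [e1 t hO]; exact W.mt.rel t (kO t ht hO)
    · rw [e2 t hO]; exact Or.inl rfl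
  · intro t ht t' ht' he
    by_cases hO : t ∈ O <;> by_cases hO' : t' ∈ O
    · rw [e1 t hO, e1 t' hO'] at he
      exact W.mt.inj (kO t ht hO) (kO t' ht' hO') he
    · rw [e1 t hO, e2 t' hO'] at he
      exact (hO' (he ▸ Ostep t hO (kO t ht hO))).elim
    · rw [e2 t hO, e1 t' hO'] at he
      exact (hO (he ▸ Ostep t' hO' (kO t' ht' hO'))).elim
    · rwa [e2 t hO, e2 t' hO'] at he
  · rintro ⟨q, hq, h3⟩
    have hn : ∀ n, q n ∈ O := by
      intro n
      by_contra hX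
      have := (h3 n).2
      rw [e2 _ hX] at this
      have := hq this
      omega
    refine W.noray ⟨q, hq, fun n => ⟨kO _ (h3 n).1 (hn n), ?_⟩⟩
    rw [← e1 _ (hn n)]; exact (h3 n).2
  · intro z hz
    by_cases hO : z ∈ O
    · obtain ⟨s, hs, n, hn, rfl⟩ := hO
      rcases n with _ | n
      · exact (hs.2 hz).elim
      · have hO' : h^[n] s ∈ O := ⟨s, hs, n, fun m hm => hn m (by omega), rfl⟩
        have hD := hn n (by omega)
        refine ⟨h^[n] s, ⟨hD.1, fun hI => hD.2 hI.1⟩, ?_⟩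
        rw [e1 _ hO', Function.iterate_succ_apply']
    · exact ⟨z, ⟨subset_nb hz, fun hI => hO hI.2⟩, e2 z hO⟩
  · rintro ⟨q, hq, h3⟩
    have hn : ∀ n, q (n + 1) ∈ O := by
      intro n
      by_contra hX
      have := (h3 n).2
      rw [e2 _ hX] at this
      have := hq this
      omega
    have key : ∀ k N s, s ∈ S → (∀ m, m < k → h^[m] s ∈ D) → h^[k] s = q (N + 1) → False := by
      intro k
      induction k with
      | zero =>
        intro N s hs _ he
        have h4 := (h3 (N + 1)).2
        rw [e1 _ (hn (N + 1))] at h4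
        have h5 := W.mt.maps _ (kO _ (h3 _).1 (hn (N + 1)))
        rw [h4, ← he] at h5
        exact hs.2 h5
      | succ k ih =>
        intro N s hs hm he
        have h4 := (h3 (N + 1)).2
        rw [e1 _ (hn (N + 1)), ← he, Function.iterate_succ_apply'] at h4
        have h5 := W.mt.inj (kO _ (h3 _).1 (hn (N + 1))) (hm k (by omega)) h4
        exact ih (N + 1) s hs (fun m h => hm m (by omega)) h5.symm
    obtain ⟨s, hs, n, hm, he⟩ := hn 0
    exact key n 0 s hs hm he

lemma swap_step {G : V → V → Prop} {A A0 B Z K I : Set V} {h : V → V}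
    (H : SwInv G A B Z (K ∪ A0) I h) {k : V} (hk : k ∈ A) (hU : Unh G (insert k K ∪ A0) B) :
    ∃ I' h', SwInv G A B Z (insert k K ∪ A0) I' h' := by
  by_cases hkI : k ∈ I
  · refine ⟨I, h, ?_, H.I_sub, H.A_sub, H.wave, H.sat, H.noback⟩
    rw [insert_union]
    exact insert_subset hkI H.K_sub
  have hkD : k ∈ nb G Z \ I := ⟨(H.A_sub hk).resolve_right hkI, hkI⟩
  let D0 := (nb G Z \ I) \ {k}
  let Q0 := I \ (insert k K ∪ A0)
  have hD0 : D0 ⊆ nb G Z \ I := sdiff_subset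
  have hhk : h k ∉ h '' D0 := by
    rintro ⟨t, ht, he⟩
    exact ht.2 (H.wave.mt.inj (hD0 ht) hkD he)
  rcases core (H.wave.mt.mono hD0) (Q0 := Q0) (fun q hq hq' => hq'.1.2 hq.1) with
    ⟨q0, hq0, z0, hz0, hz0', h2, hf, hM, him⟩ | ⟨Z2, hs, hu, hq, hM⟩
  · have hqnb : q0 ∈ nb G Z := mem_nb_iff.2 ⟨h2 q0, hM.maps q0 (mem_insert _ _), hM.rel q0 (mem_insert _ _)⟩
    have hqk : q0 ≠ k := fun e => hkI (e ▸ hq0.1)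
    have hdom : nb G Z \ (insert k I \ {q0}) = insert q0 D0 := by
      ext t
      simp only [mem_sdiff, mem_insert_iff, mem_singleton_iff, D0, not_and, not_not, not_or]
      constructor
      · rintro ⟨h1, h2⟩
        by_cases e : t = q0
        · exact Or.inl e
        · refine Or.inr ⟨⟨h1, fun hI => e (h2 (Or.inr hI))⟩, fun ek => e (h2 (Or.inl ek))⟩
      · rintro (rfl | ⟨⟨h1, h2⟩, h3⟩)
        · exact ⟨hqnb, fun _ => rfl⟩
        · exact ⟨h1, fun h => (h.elim h3 h2).elim⟩
    have hfd : (insert q0 D0 \ (nb G Z \ I)).Finite := by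
      refine (finite_singleton q0).subset ?_
      rintro t ⟨rfl | ht, h2⟩
      · rfl
      · exact (h2 (hD0 ht)).elim
    refine ⟨insert k I \ {q0}, h2, ?_, ?_, ?_, ⟨H.wave.disj, ?_, ?_⟩, ?_, ?_⟩
    · intro t ht
      refine ⟨?_, fun e => hq0.2 ((mem_singleton_iff.1 e) ▸ ht)⟩
      rw [insert_union] at ht
      exact ht.imp id (fun h => H.K_sub h)
    · rintro t ⟨rfl | h, _⟩
      · exact hk
      · exact H.I_sub h
    · intro t ht
      by_cases e : t = q0
      · exact Or.inl (e ▸ hqnb)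
      · rcases H.A_sub ht with h1 | h1
        · exact Or.inl h1
        · exact Or.inr ⟨Or.inr h1, e⟩
    · rw [hdom]; exact hM
    · rw [hdom]; exact H.wave.noray.finite_change hf hfd
    · rw [hdom, him]
      intro z hz
      obtain ⟨t, ht, rfl⟩ := H.sat hz
      by_cases e : t = k
      · subst e
        obtain ⟨t', ht', he'⟩ := H.sat hz0
        by_cases e' : t' = t
        · subst e'; exact Or.inl he'
        · exact (hz0' ⟨t', ⟨ht', e'⟩, he'⟩).elim
      · exact Or.inr ⟨t, ⟨ht, e⟩, rfl⟩
    · rw [hdom]; exact H.noback.finite_change hf hfd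
  · exfalso
    have hsub : nb G Z2 \ (insert k K ∪ A0) ⊆ D0 := by
      rintro t ⟨ht, ht'⟩
      refine ⟨⟨nb_mono hs ht, fun hI => hq t ⟨hI, ht'⟩ ht⟩, fun e => ht' (Or.inl (Or.inl e))⟩
    have := hU Z2 h ⟨fun z hz => H.wave.disj z (hs hz), hM _ hsub sdiff_subset,
      H.wave.noray.mono (hsub.trans hD0)⟩ (hu _ (H.wave.mt.maps k hkD) hhk)
    exact hhk (image_mono hsub this)

lemma swap {G : V → V → Prop} {A A0 B Z K : Set V} {h : V → V} (W : Wave G A B Z h)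
    (hA0 : A0 ⊆ A) (hAB : A0 ⊆ B) (hK : K ⊆ A) (hf : K.Finite) (hU : Unh G (K ∪ A0) B) :
    ∃ I h', SwInv G A B Z (K ∪ A0) I h' := by
  induction K, hf using Set.Finite.induction_on with
  | empty => simpa using swap_init W hA0 hAB
  | @insert k K _ _ ih =>
    obtain ⟨I, h', hI⟩ := ih ((subset_insert _ _).trans hK)
      (hU.antitone (union_subset_union_left _ (subset_insert _ _)))
    exact swap_step hI (hK (mem_insert _ _)) hU

/-- every element of `I` is at the end of an orbit starting at the boundary -/
lemma SwInv.back {G : V → V → Prop} {A B Z K I : Set V} {h : V → V} (H : SwInv G A B Z K I h)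
    {i : V} (hi : i ∈ I) : ∃ s ∈ (nb G Z ∪ A) \ Z, ∃ n, (∀ m, m < n → h^[m] s ∈ nb G Z \ I) ∧ h^[n] s = i := by
  classical
  by_contra hc
  push Not at hc
  let P : V → Prop := fun t => t ∈ nb G Z ∪ A ∧ ∃ n, (∀ m, m < n → h^[m] t ∈ nb G Z \ I) ∧ h^[n] t = i
  have hstep : ∀ t, P t → ∃ t', P t' ∧ t' ∈ nb G Z \ I ∧ h t' = t := by
    rintro t ⟨ht, n, hn, he⟩
    by_cases hz : t ∈ Z
    swap
    · exact (hc t ⟨ht, hz⟩ n hn he).elim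
    obtain ⟨t', ht', rfl⟩ := H.sat hz
    refine ⟨t', ⟨Or.inl ht'.1, n + 1, ?_, he⟩, ht', rfl⟩
    intro m hm
    rcases m with _ | m
    · exact ht'
    · exact hn m (by omega)
  have hPi : P i := ⟨Or.inr (H.I_sub hi), 0, by simp, rfl⟩
  choose! g hg1 hg2 hg3 using hstep
  let q : ℕ → V := fun n => g^[n] i
  have hqP : ∀ n, P (q n) := by
    intro n
    induction n with
    | zero => exact hPi
    | succ n ih => simp only [q, Function.iterate_succ_apply']; exact hg1 _ ih
  have hqs : ∀ n, q (n + 1) ∈ nb G Z \ I ∧ h (q (n + 1)) = q n := by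
    intro n
    have : q (n + 1) = g (q n) := by simp only [q, Function.iterate_succ_apply']
    rw [this]
    exact ⟨hg2 _ (hqP n), hg3 _ (hqP n)⟩
  have hinj : ∀ a b, q a = q (a + b + 1) → False := by
    intro a
    induction a with
    | zero =>
      intro b he
      have h1 := (hqs (0 + b)).1
      rw [← he] at h1
      exact h1.2 hi
    | succ a ih =>
      intro b he
      apply ih b
      rw [← (hqs a).2, he, show a + 1 + b + 1 = (a + b + 1) + 1 by omega, (hqs (a + b + 1)).2]
  refine H.noback ⟨fun n => q (n + 1), ?_, fun n => ⟨(hqs n).1, (hqs (n + 1)).2⟩⟩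
  intro a b he
  by_contra hne
  rcases Nat.lt_or_gt_of_ne hne with h1 | h1
  · exact hinj (a + 1) (b - a - 1) (by
      rw [show a + 1 + (b - a - 1) + 1 = b + 1 by omega]; exact he)
  · exact hinj (b + 1) (a - b - 1) (by
      rw [show b + 1 + (a - b - 1) + 1 = a + 1 by omega]; exact he.symm)

end Flm

namespace Flm
open Set

/-- the edges used by the concatenated linkage -/
def Used (G : V → V → Prop) (A Z I : Set V) (h : V → V) (q : V → ℕ → V) (nq : V → ℕ) (x y : V) : Prop :=
  (∃ t ∈ nb G Z \ I, h t ≠ t ∧ x = h t ∧ y = t) ∨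
  (∃ s ∈ (nb G Z ∪ A) \ Z, ∃ m, m < nq s ∧ x = q s m ∧ y = q s (m + 1))

lemma Link.avoid {G : V → V → Prop} {T B : Set V} {q nq} (L : Link G T B q nq) {s : V} (hs : s ∈ T)
    {m : ℕ} (hm : 0 < m) (hm' : m ≤ nq s) : q s m ∉ T := by
  intro h
  have := L.inj s hs _ h m 0 hm' (Nat.zero_le _) (L.start _ h).symm
  omega

lemma Link.avoidZ {G : V → V → Prop} {T B Z : Set V} {q nq} (L : Link G T B q nq) {s : V} (hs : s ∈ T)
    (hZ : Z ⊆ T) (hsZ : s ∉ Z) {m : ℕ} (hm' : m ≤ nq s) : q s m ∉ Z := by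
  intro h
  rcases Nat.eq_zero_or_pos m with rfl | h0
  · rw [L.start s hs] at h; exact hsZ h
  · exact L.avoid hs h0 hm' (hZ h)

lemma used_sub {G : V → V → Prop} {A B Z I : Set V} {h : V → V} {q nq} (W : Wave G I B Z h)
    (L : Link G (nb G Z ∪ A) (B ∪ Z) q nq) {x y : V} (hu : Used G A Z I h q nq x y) : G x y := by
  rcases hu with ⟨t, ht, hne, rfl, rfl⟩ | ⟨s, hs, m, hm, rfl, rfl⟩
  · exact (W.mt.rel y ht).resolve_left hne
  · exact L.step s hs.1 m hm

lemma used_unique {G : V → V → Prop} {A B Z I : Set V} {h : V → V} {q nq} (W : Wave G I B Z h)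
    (L : Link G (nb G Z ∪ A) (B ∪ Z) q nq) {x y y' : V} (hu : Used G A Z I h q nq x y)
    (hu' : Used G A Z I h q nq x y') : y = y' := by
  have hZ : Z ⊆ nb G Z ∪ A := fun z hz => Or.inl (subset_nb hz)
  rcases hu with ⟨t, ht, hne, rfl, rfl⟩ | ⟨s, hs, m, hm, rfl, rfl⟩
  · rcases hu' with ⟨t', ht', hne', he, rfl⟩ | ⟨s, hs, m, hm, he, rfl⟩
    · exact W.mt.inj ht ht' he
    · exact (L.avoidZ hs.1 hZ hs.2 hm.le (he ▸ W.mt.maps _ ht)).elim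
  · rcases hu' with ⟨t', ht', hne', he, rfl⟩ | ⟨s', hs', m', hm', he, rfl⟩
    · exact (L.avoidZ hs.1 hZ hs.2 hm.le (he ▸ W.mt.maps _ ht')).elim
    · obtain ⟨rfl, rfl⟩ := L.inj s hs.1 s' hs'.1 m m' hm.le hm'.le he
      rfl

lemma concat {G : V → V → Prop} {A B Z K I : Set V} {h : V → V} {q nq} (H : SwInv G A B Z K I h)
    (L : Link G (nb G Z ∪ A) (B ∪ Z) q nq) :
    ∃ (l : V → ℕ → V) (N k : V → ℕ), Link (Used G A Z I h q nq) I B l N ∧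
      (∀ i ∈ I, k i ≤ N i ∧ ∀ m, m ≤ N i → (l i m ∈ (nb G Z ∪ A) \ Z ↔ m = k i)) ∧
      (∀ s ∈ (nb G Z ∪ A) \ Z, ∃ i ∈ I, l i (k i) = s) := by
  have hZ : Z ⊆ nb G Z ∪ A := fun z hz => Or.inl (subset_nb hz)
  have hb : ∀ i, ∃ s n, i ∈ I → s ∈ (nb G Z ∪ A) \ Z ∧ (∀ m, m < n → h^[m] s ∈ nb G Z \ I) ∧ h^[n] s = i := by
    intro i
    by_cases hi : i ∈ I
    · obtain ⟨s, hs, n, h1, h2⟩ := H.back hi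
      exact ⟨s, n, fun _ => ⟨hs, h1, h2⟩⟩
    · exact ⟨i, 0, fun h => (hi h).elim⟩
  choose s k hsk using hb
  have hS : ∀ i ∈ I, s i ∈ (nb G Z ∪ A) \ Z := fun i hi => (hsk i hi).1
  have hD : ∀ i ∈ I, ∀ m, m < k i → h^[m] (s i) ∈ nb G Z \ I := fun i hi => (hsk i hi).2.1
  have hE : ∀ i ∈ I, h^[k i] (s i) = i := fun i hi => (hsk i hi).2.2
  have hR : ∀ x ∈ (nb G Z ∪ A) \ Z, x ∉ h '' (nb G Z \ I) := fun x hx => H.wave.bdry_not_range hx.2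
  have ou : ∀ x ∈ (nb G Z ∪ A) \ Z, ∀ y ∈ (nb G Z ∪ A) \ Z, ∀ n m, (∀ k, k < n → h^[k] x ∈ nb G Z \ I) →
     (∀ k, k < m → h^[k] y ∈ nb G Z \ I) → h^[n] x = h^[m] y → x = y ∧ n = m :=
    fun x hx y hy n m => orbit_unique H.wave.mt.inj (hR x hx) (hR y hy) n m
  let l : V → ℕ → V := fun i m => if m ≤ k i then h^[k i - m] (s i) else q (s i) (m - k i)
  have l1 : ∀ i m, m ≤ k i → l i m = h^[k i - m] (s i) := fun i m hm => if_pos hm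
  have l2 : ∀ i m, i ∈ I → k i ≤ m → l i m = q (s i) (m - k i) := by
    intro i m hi hm
    rcases hm.eq_or_lt with rfl | hm
    · simp [l, L.start _ (hS i hi).1]
    · exact if_neg (by omega)
  -- membership
  have mZ : ∀ i ∈ I, ∀ m, m < k i → l i m ∈ Z := by
    intro i hi m hm
    rw [l1 i m hm.le, show k i - m = (k i - m - 1) + 1 by omega, Function.iterate_succ_apply']
    exact H.wave.mt.maps _ (hD i hi _ (by omega))
  have mZ' : ∀ i ∈ I, ∀ m, k i ≤ m → m ≤ k i + nq (s i) → l i m ∉ Z := by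
    intro i hi m hm hm'
    rw [l2 i m hi hm]
    exact L.avoidZ (hS i hi).1 hZ (hS i hi).2 (by omega)
  refine ⟨l, fun i => k i + nq (s i), k, ⟨?_, ?_, ?_, ?_⟩, ?_, ?_⟩
  · intro i hi
    rw [l1 i 0 (Nat.zero_le _)]
    exact hE i hi
  · intro i hi m hm
    by_cases hmk : m < k i
    · left
      have hD' := hD i hi (k i - (m + 1)) (by omega)
      have e : h^[k i - m] (s i) = h (h^[k i - (m + 1)] (s i)) := by
        rw [show k i - m = (k i - (m + 1)) + 1 by omega, Function.iterate_succ_apply']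
      refine ⟨_, hD', ?_, ?_, l1 i (m + 1) hmk⟩
      · intro e'
        rw [← e] at e'
        have := (ou _ (hS i hi) _ (hS i hi) _ _ (fun j hj => hD i hi j (by omega))
          (fun j hj => hD i hi j (by omega)) e').2
        omega
      · rw [l1 i m hmk.le, e]
    · right
      refine ⟨s i, hS i hi, m - k i, by omega, l2 i m hi (by omega), ?_⟩
      rw [l2 i (m + 1) hi (by omega)]
      congr 1; omega
  · intro i hi
    have h1 := L.fin _ (hS i hi).1
    have h2 := mZ' i hi (k i + nq (s i)) (by omega) le_rfl
    have h3 := l2 i (k i + nq (s i)) hi (by omega)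
    rw [show k i + nq (s i) - k i = nq (s i) by omega] at h3
    rw [h3] at h2 ⊢
    exact h1.resolve_right h2
  · intro i hi i' hi' m m' hm hm' he
    by_cases h1 : m < k i <;> by_cases h2 : m' < k i'
    · rw [l1 i m h1.le, l1 i' m' h2.le] at he
      obtain ⟨e1, e2⟩ := ou _ (hS i hi) _ (hS i' hi') _ _ (fun j hj => hD i hi j (by omega))
          (fun j hj => hD i' hi' j (by omega)) he
      have : k i = k i' := by
        by_contra hne
        rcases Nat.lt_or_gt_of_ne hne with h | h
        · have := (hD i' hi' _ h).2
          rw [← e1, hE i hi] at this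
          exact this hi
        · have := (hD i hi _ h).2
          rw [e1, hE i' hi'] at this
          exact this hi'
      refine ⟨?_, by omega⟩
      rw [← hE i hi, ← hE i' hi', e1, this]
    · exact (mZ' i' hi' m' (by omega) hm' (he ▸ mZ i hi m h1)).elim
    · exact (mZ' i hi m (by omega) hm (he ▸ mZ i' hi' m' h2)).elim
    · rw [l2 i m hi (by omega), l2 i' m' hi' (by omega)] at he
      obtain ⟨e1, e2⟩ := L.inj _ (hS i hi).1 _ (hS i' hi').1 _ _ (by omega) (by omega) he
      have : k i = k i' := by
        by_contra hne
        rcases Nat.lt_or_gt_of_ne hne with h | h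
        · have := (hD i' hi' _ h).2
          rw [← e1, hE i hi] at this
          exact this hi
        · have := (hD i hi _ h).2
          rw [e1, hE i' hi'] at this
          exact this hi'
      refine ⟨?_, by omega⟩
      rw [← hE i hi, ← hE i' hi', e1, this]
  · intro i hi
    refine ⟨Nat.le_add_right _ _, fun m hm => ⟨?_, ?_⟩⟩
    · intro hmem
      by_contra hne
      rcases Nat.lt_or_gt_of_ne hne with h1 | h1
      · exact hmem.2 (mZ i hi m h1)
      · rw [l2 i m hi h1.le] at hmem
        have hm2 : m ≤ k i + nq (s i) := hm
        exact L.avoid (hS i hi).1 (by omega) (by omega) hmem.1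
    · rintro rfl
      rw [l1 i _ le_rfl, Nat.sub_self]
      exact hS i hi
  · intro x hx
    have hx' : x ∈ nb G Z ∪ I := hx.1.elim Or.inl (fun h => H.A_sub h)
    obtain ⟨n, hn, hm⟩ := endpoint H.wave hx' (hR x hx)
    refine ⟨_, hn, ?_⟩
    rw [l1 _ _ le_rfl, Nat.sub_self]
    exact (ou _ (hS _ hn) _ hx _ _ (hD _ hn) hm (hE _ hn)).1

end Flm

namespace Flm
open Set

lemma mkPath {X : Set (V × V)} (f : ℕ → V) (n : ℕ) (hs : ∀ m, m < n → (f m, f (m + 1)) ∈ X)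
    (hi : InjOn f (Iic n)) : ∃ p : Dipath X, p.start = f 0 ∧ p.last = f n ∧ p.support = f '' Iic n ∧
      p.edgeSet = {e | ∃ m, m < n ∧ e = (f m, f (m + 1))} ∧
      (∀ k, n = k + 1 → p.lastEdge? = some (f k, f n)) := by
  have e0 : f 0 :: (List.range n).map (fun m => f (m + 1)) = (List.range (n + 1)).map f := by
    rw [List.range_succ_eq_map, List.map_cons, List.map_map]
    rfl
  have hch : List.IsChain (fun a b => (a, b) ∈ X) (f 0 :: (List.range n).map (fun m => f (m + 1))) := by
    rw [e0, List.isChain_map, List.isChain_range_succ]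
    exact hs
  have hnd : (f 0 :: (List.range n).map (fun m => f (m + 1))).Nodup := by
    rw [e0]
    refine List.Nodup.map_on ?_ List.nodup_range
    intro a ha b hb he
    simp only [List.mem_range] at ha hb
    exact hi (show a ≤ n by omega) (show b ≤ n by omega) he
  let p : Dipath X := ⟨f 0, (List.range n).map (fun m => f (m + 1)), hch, hnd⟩
  have hv : p.verts = (List.range (n + 1)).map f := e0
  have he : p.edges = (List.range n).map (fun m => (f m, f (m + 1))) := by
    unfold Dipath.edges
    rw [hv]
    apply List.ext_getElem
    · simp [p]
    · intro i h1 h2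
      simp [p]
  refine ⟨p, rfl, ?_, ?_, ?_, ?_⟩
  · have : p.last = ((List.range (n + 1)).map f).getLast (by simp) := by
      unfold Dipath.last
      congr 1
    rw [this]
    simp
  · ext x
    show x ∈ p.verts ↔ _
    rw [hv]
    simp only [List.mem_map, List.mem_range, mem_image, mem_Iic, Nat.lt_succ_iff]
  · ext e
    show e ∈ p.edges ↔ _
    rw [he]
    simp only [List.mem_map, List.mem_range]
    constructor
    · rintro ⟨m, h1, rfl⟩; exact ⟨m, h1, rfl⟩
    · rintro ⟨m, h1, rfl⟩; exact ⟨m, h1, rfl⟩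
  · rintro k rfl
    unfold Dipath.lastEdge?
    rw [he, List.getLast?_map, List.range_succ]
    simp

/-- reversed edge relation -/
def gr (F : Set (V × V)) (u v : V) : Prop := (v, u) ∈ F

/-- in-neighbours apart from the root -/
def In (F : Set (V × V)) (r v : V) : Set V := {i | i ≠ r ∧ (i, v) ∈ F}

/-- target side -/
def Bs (D : Set (V × V)) (r w : V) : Set V := {b | (r, b) ∈ D} ∪ {r, w}

/-- standing assumption -/
def Good (D : Set (V × V)) (r : V) : Prop := ∀ e ∈ D, e.1 ≠ e.2 ∧ e.2 ≠ r

lemma gr_mono {F F' : Set (V × V)} (h : F ⊆ F') : ∀ x y, gr F x y → gr F' x y := fun _ _ hx => h hx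

lemma In_mono {F F' : Set (V × V)} (h : F ⊆ F') (r v : V) : In F r v ⊆ In F' r v := fun _ hx => ⟨hx.1, h hx.2⟩

lemma nb_gmono {G G' : V → V → Prop} (h : ∀ x y, G x y → G' x y) (Z : Set V) : nb G Z ⊆ nb G' Z := by
  rintro t (h1 | ⟨z, hz, h1⟩)
  · exact Or.inl h1
  · exact Or.inr ⟨z, hz, h _ _ h1⟩

lemma rpath {D L X : Set (V × V)} {r v : V} (hvr : v ≠ r)
    (hR : ∀ b, (r, b) ∈ D → (r, b) ∈ L) (hX : ∀ e ∈ L, e ≠ (r, v) → e ∈ X) {l N}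
    (K : Link (gr L) (In L r v ∪ {r, v}) (Bs D r v) l N) {i : V} (hi : i ∈ In L r v) (hiv : i ≠ v) :
    ∃ p : Dipath X, p.start = r ∧ p.last = v ∧ p.support = {r, v} ∪ l i '' Iic (N i) ∧
      p.edgeSet ⊆ L ∧ p.lastEdge? = some (i, v) := by
  have hr : ∀ m, m ≤ N i → l i m ≠ r := by
    intro m hm he
    exact hi.1 (K.inj i (Or.inl hi) r (Or.inr (Or.inl rfl)) m 0 hm (Nat.zero_le _)
      (he.trans (K.start r (Or.inr (Or.inl rfl))).symm)).1
  have hv : ∀ m, m ≤ N i → l i m ≠ v := by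
    intro m hm he
    exact hiv (K.inj i (Or.inl hi) v (Or.inr (Or.inr rfl)) m 0 hm (Nat.zero_le _)
      (he.trans (K.start v (Or.inr (Or.inr rfl))).symm)).1
  have hl0 := K.start i (Or.inl hi)
  have hend : (r, l i (N i)) ∈ L := by
    rcases K.fin i (Or.inl hi) with h | h | h
    · exact hR _ h
    · exact (hr _ le_rfl h).elim
    · exact (hv _ le_rfl h).elim
  let f : ℕ → V := fun m => if m = 0 then r else if m ≤ N i + 1 then l i (N i + 1 - m) else v
  have f0 : f 0 = r := rfl
  have f1 : ∀ m, m ≤ N i → f (m + 1) = l i (N i - m) := by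
    intro m hm
    simp only [f, Nat.add_one_ne_zero, if_false, Nat.add_le_add_iff_right, hm, if_true]
    congr 1; omega
  have f2 : f (N i + 1 + 1) = v := by simp [f]
  have hst : ∀ m, m < N i + 1 + 1 → (f m, f (m + 1)) ∈ L ∧ (f m, f (m + 1)) ≠ (r, v) := by
    intro m hm
    rcases m with _ | m
    · rw [f0, f1 0 (Nat.zero_le _)]
      refine ⟨hend, fun e => hv _ le_rfl (Prod.ext_iff.1 e).2⟩
    · rw [f1 m (by omega)]
      refine ⟨?_, fun e => hr _ (Nat.sub_le _ _) (Prod.ext_iff.1 e).1⟩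
      by_cases hm' : m + 1 ≤ N i
      · rw [f1 _ hm']
        have := K.step i (Or.inl hi) (N i - (m + 1)) (by omega)
        rw [show N i - (m + 1) + 1 = N i - m by omega] at this
        exact this
      · obtain rfl : m = N i := by omega
        rw [f2, Nat.sub_self, hl0]
        exact hi.2
  have hinj : InjOn f (Iic (N i + 1 + 1)) := by
    have cl : ∀ m, m ≤ N i + 1 + 1 → m = 0 ∨ (∃ k, k ≤ N i ∧ m = k + 1) ∨ m = N i + 1 + 1 := by
      intro m hm
      rcases m with _ | m
      · exact Or.inl rfl
      · by_cases h : m ≤ N i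
        · exact Or.inr (Or.inl ⟨m, h, rfl⟩)
        · right; right; omega
    intro a ha b hb he
    rcases cl a ha with rfl | ⟨k, hk, rfl⟩ | rfl <;> rcases cl b hb with rfl | ⟨k', hk', rfl⟩ | rfl
    · rfl
    · rw [f0, f1 _ hk'] at he; exact (hr _ (Nat.sub_le _ _) he.symm).elim
    · rw [f0, f2] at he; exact (hvr he.symm).elim
    · rw [f0, f1 _ hk] at he; exact (hr _ (Nat.sub_le _ _) he).elim
    · rw [f1 _ hk, f1 _ hk'] at he
      have := (K.inj i (Or.inl hi) i (Or.inl hi) _ _ (Nat.sub_le _ _) (Nat.sub_le _ _) he).2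
      omega
    · rw [f1 _ hk, f2] at he; exact (hv _ (Nat.sub_le _ _) he).elim
    · rw [f0, f2] at he; exact (hvr he).elim
    · rw [f1 _ hk', f2] at he; exact (hv _ (Nat.sub_le _ _) he.symm).elim
    · rfl
  obtain ⟨p, p1, p2, p3, p4, p5⟩ := mkPath (X := X) f (N i + 1 + 1) (fun m hm => hX _ (hst m hm).1 (hst m hm).2) hinj
  refine ⟨p, p1, p2.trans f2, ?_, ?_, ?_⟩
  · rw [p3]
    ext x
    constructor
    · rintro ⟨m, hm, rfl⟩
      rcases m with _ | m
      · exact Or.inl (Or.inl rfl)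
      · by_cases h : m ≤ N i
        · rw [f1 m h]; exact Or.inr ⟨_, Nat.sub_le _ _, rfl⟩
        · have : m = N i + 1 := by have : m + 1 ≤ N i + 1 + 1 := hm; omega
          subst this
          exact Or.inl (Or.inr f2)
    · rintro ((rfl | rfl) | ⟨m, hm, rfl⟩)
      · exact ⟨0, Nat.zero_le _, rfl⟩
      · exact ⟨N i + 1 + 1, le_refl (N i + 1 + 1), f2⟩
      · have hm' : m ≤ N i := hm
        refine ⟨N i - m + 1, ?_, ?_⟩
        · show N i - m + 1 ≤ N i + 1 + 1
          omega
        · rw [f1 _ (Nat.sub_le _ _)]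
          congr 1; omega
  · rw [p4]
    rintro e ⟨m, hm, rfl⟩
    exact (hst m hm).1
  · rw [p5 _ rfl, f1 _ le_rfl, f2, Nat.sub_self, hl0]

lemma gset_of {D L : Set (V × V)} {r v : V} (hg : Good D r) (hLD : L ⊆ D) (hvr : v ≠ r)
    (hR : ∀ b, (r, b) ∈ D → (r, b) ∈ L) {l N}
    (K : Link (gr L) (In L r v ∪ {r, v}) (Bs D r v) l N) : inEdges L v ∈ GSet L r v := by
  have hiv : ∀ i ∈ In L r v, i ≠ v := fun i hi => (hg _ (hLD hi.2)).1
  have hp := fun i (hi : i ∈ In L r v) => rpath (X := L) hvr hR (fun e he _ => he) K hi (hiv i hi)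
  let P : Set (Dipath L) := {p | (∃ i ∈ In L r v, p.start = r ∧ p.last = v ∧
    p.support = {r, v} ∪ l i '' Iic (N i) ∧ p.lastEdge? = some (i, v)) ∧
      ∀ i (hi : i ∈ In L r v), p.lastEdge? = some (i, v) → p = (hp i hi).choose}
  let Q : Set (Dipath L) := {p | p.start = r ∧ p.last = v ∧ p.support = {r, v} ∧ p.lastEdge? = some (r, v)
    ∧ p.rest = [v]}
  have hPP : ∀ i (hi : i ∈ In L r v), (hp i hi).choose ∈ P := by
    intro i hi
    have h1 := (hp i hi).choose_spec
    refine ⟨⟨i, hi, h1.1, h1.2.1, h1.2.2.1, h1.2.2.2.2⟩, ?_⟩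
    intro j hj he
    rw [h1.2.2.2.2] at he
    have : i = j := (Prod.ext_iff.1 (Option.some.inj he)).1
    subst this
    rfl
  have hQuniq : ∀ p ∈ Q, ∀ q ∈ Q, p = q := by
    rintro ⟨a, b, c, d⟩ ⟨h1, -, -, -, h2⟩ ⟨a', b', c', d'⟩ ⟨h1', -, -, -, h2'⟩
    simp only at h1 h2 h1' h2'
    subst h2 h2'
    subst h1
    subst h1'
    rfl
  refine ⟨P ∪ Q, ⟨?_, ?_⟩, ?_⟩
  · rintro p (⟨⟨i, hi, h1, h2, _⟩, _⟩ | ⟨h1, h2, _⟩)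
    · exact ⟨h1, h2⟩
    · exact ⟨h1, h2⟩
  · rintro p hp' q hq' hne x ⟨hx, hx'⟩
    rcases hp' with ⟨⟨i, hi, h1, h2, h3, h4⟩, hu⟩ | hp'
    · rcases hq' with ⟨⟨j, hj, g1, g2, g3, g4⟩, gu⟩ | hq'
      · rw [h3] at hx
        rw [g3] at hx'
        rcases hx with hx | ⟨m, hm, rfl⟩
        · exact hx
        rcases hx' with hx' | ⟨m', hm', he⟩
        · exact hx'
        have := (K.inj i (Or.inl hi) j (Or.inl hj) m m' hm hm' he.symm).1
        subst this
        exact (hne ((hu i hi h4).trans (gu i hi g4).symm)).elim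
      · rw [hq'.2.2.1] at hx'
        exact hx'
    · rw [hp'.2.2.1] at hx
      exact hx
  · ext ⟨a, b⟩
    constructor
    · rintro ⟨p, ⟨⟨i, hi, h1, h2, h3, h4⟩, hu⟩ | hp', he⟩
      · rw [h4] at he
        obtain ⟨rfl, rfl⟩ := Prod.ext_iff.1 (Option.some.inj he)
        exact ⟨hi.2, rfl⟩
      · have hst := hp'.1
        rw [hp'.2.2.2.1] at he
        obtain ⟨rfl, rfl⟩ := Prod.ext_iff.1 (Option.some.inj he)
        refine ⟨?_, rfl⟩
        have h1 := p.chain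
        rw [hp'.2.2.2.2, hst] at h1
        have h1 : List.IsChain _ _ := h1
        simpa using h1
    · rintro ⟨h1, h2⟩
      simp only at h2
      subst h2
      by_cases har : a = r
      · subst har
        obtain ⟨p, p1, p2, p3, p4, p5⟩ := mkPath (X := L) (fun m => if m = 0 then a else b) 1
          (by intro m hm; obtain rfl : m = 0 := by omega
              simpa using h1)
          (by intro x hx y hy he
              simp only [mem_Iic] at hx hy
              have : x = 0 ∨ x = 1 := by omega
              have : y = 0 ∨ y = 1 := by omega
              rcases ‹x = 0 ∨ x = 1› with rfl | rfl <;> rcases ‹y = 0 ∨ y = 1› with rfl | rfl <;>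
                simp_all)
        have h1' : List.IsChain (fun a b => (a, b) ∈ L) (a :: [b]) := by simpa using h1
        let p' : Dipath L := ⟨a, [b], h1', by simpa using hvr.symm⟩
        refine ⟨p', Or.inr ⟨rfl, rfl, ?_, rfl, rfl⟩, rfl⟩
        ext x
        show x ∈ [a, b] ↔ _
        simp
      · have hi : a ∈ In L r b := ⟨har, h1⟩
        exact ⟨_, Or.inl (hPP a hi), (hp a hi).choose_spec.2.2.2.2⟩

lemma vlarge_of {E D L : Set (V × V)} {r v : V} (hDE : D ⊆ E) (hg : Good D r) (hLD : L ⊆ D) (hvr : v ≠ r)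
    (hR : ∀ b, (r, b) ∈ D → (r, b) ∈ L) (hED : (r, v) ∈ E → (r, v) ∈ D) {S : Set V} (hrS : r ∈ S) (hvS : v ∈ S)
    (hsep : IsSeparation (E \ {(r, v)}) r v (S \ {r, v})) {l} {N k : V → ℕ}
    (K : Link (gr L) (In L r v ∪ {r, v}) (Bs D r v) l N)
    (hk : ∀ i ∈ In L r v ∪ {r, v}, k i ≤ N i ∧ ∀ m, m ≤ N i → (l i m ∈ S ↔ m = k i))
    (hS : ∀ s ∈ S, ∃ i ∈ In L r v ∪ {r, v}, l i (k i) = s) : VLarge E r L v := by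
  refine ⟨fun h => hR _ (hED h), ?_⟩
  have hiv : ∀ i ∈ In L r v, i ≠ v := fun i hi => (hg _ (hLD hi.2)).1
  have hp := fun i (hi : i ∈ In L r v) => rpath (X := E \ {(r, v)}) hvr hR
    (fun e he hne => ⟨hDE (hLD he), hne⟩) K hi (hiv i hi)
  let P : Set (Dipath (E \ {(r, v)})) := {p | ∃ i, ∃ hi : i ∈ In L r v, p = (hp i hi).choose}
  have hrv : ∀ x ∈ ({r, v} : Set V), x ∈ In L r v ∪ {r, v} := fun x hx => Or.inr hx
  have avoid : ∀ i ∈ In L r v, ∀ m, m ≤ N i → l i m ∉ ({r, v} : Set V) := by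
    intro i hi m hm hx
    have := (K.inj i (Or.inl hi) _ (hrv _ hx) m 0 hm (Nat.zero_le _) (K.start _ (hrv _ hx)).symm).1
    rw [← this] at hx
    rcases hx with h | h
    · exact hi.1 h
    · exact hiv i hi h
  refine ⟨P, ⟨⟨?_, ?_⟩, S \ {r, v}, hsep, ?_, ?_⟩, ?_⟩
  · rintro p ⟨i, hi, rfl⟩
    exact ⟨(hp i hi).choose_spec.1, (hp i hi).choose_spec.2.1⟩
  · rintro p ⟨i, hi, rfl⟩ q ⟨j, hj, rfl⟩ hne x ⟨hx, hx'⟩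
    rw [(hp i hi).choose_spec.2.2.1] at hx
    rw [(hp j hj).choose_spec.2.2.1] at hx'
    rcases hx with hx | ⟨m, hm, rfl⟩
    · exact hx
    rcases hx' with hx' | ⟨m', hm', he⟩
    · exact hx'
    have := (K.inj i (Or.inl hi) j (Or.inl hj) m m' hm hm' he.symm).1
    subst this
    exact (hne rfl).elim
  · rintro p ⟨i, hi, rfl⟩
    rw [(hp i hi).choose_spec.2.2.1]
    have hki := hk i (Or.inl hi)
    refine ⟨l i (k i), ⟨Or.inr ⟨k i, hki.1, rfl⟩, (hki.2 _ hki.1).2 rfl, avoid i hi _ hki.1⟩, ?_⟩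
    rintro y ⟨hy | ⟨m, hm, rfl⟩, hy1, hy2⟩
    · exact (hy2 hy).elim
    · rw [(hki.2 m hm).1 hy1]
  · rintro s ⟨hs, hs'⟩
    obtain ⟨i, hi, he⟩ := hS s hs
    rcases hi with hi | hi
    · refine ⟨_, ⟨i, hi, rfl⟩, ?_⟩
      rw [(hp i hi).choose_spec.2.2.1]
      exact Or.inr ⟨k i, (hk i (Or.inl hi)).1, he⟩
    · exfalso
      have hiS : l i 0 ∈ S := by
        rw [K.start i (Or.inr hi)]
        rcases hi with rfl | rfl
        · exact hrS
        · exact hvS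
      have h0 := ((hk i (Or.inr hi)).2 0 (Nat.zero_le _)).1 hiS
      rw [← h0, K.start i (Or.inr hi)] at he
      exact hs' (he ▸ hi)
  · rintro p ⟨i, hi, rfl⟩
    exact (hp i hi).choose_spec.2.2.2.1

/-- domination -/
def Dom (D : Set (V × V)) (r : V) (L : Set (V × V)) (v u : V) : Prop :=
  ∃ C ⊆ In L r v, ∃ Z h, Wave (gr L) (C ∪ {r, v}) (Bs D r v) Z h ∧ u ∈ nb (gr L) Z

lemma closed {D D' L : Set (V × V)} {r : V}
    (hdom : ∀ u v, (u, v) ∈ D' → (u, v) ∉ L → Dom D r L v u) {w : V}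
    {Z : Set V} {h : V → V} (W : GWave (gr L) (In L r w ∪ {r, w}) (Bs D r w) Z h)
    {u v : V} (huv : (u, v) ∈ D') (hv : v ∈ Z ∨ v = w) (hu : u ≠ r) :
    u ∈ nb (gr L) Z ∪ (In L r w ∪ {r, w}) := by
  by_cases hL : (u, v) ∈ L
  · rcases hv with hv | rfl
    · exact Or.inl (Or.inr ⟨v, hv, hL⟩)
    · exact Or.inr (Or.inl ⟨hu, hL⟩)
  obtain ⟨C, hC, Z1, h1, W1, hu1⟩ := hdom u v huv hL
  by_cases hvw : v = w
  · subst hvw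
    have hs : nb (gr L) Z1 \ (In L r v ∪ {r, v}) ⊆ nb (gr L) Z1 \ (C ∪ {r, v}) :=
      sdiff_subset_sdiff_right (union_subset_union_left _ hC)
    exact Or.inl (nb_mono (W.2 Z1 h1 ⟨W1.disj, W1.mt.mono hs, W1.noray.mono hs⟩) hu1)
  have hvZ := hv.resolve_right hvw
  let Z2 := Z1 \ {w}
  have hZ2 : Z2 ⊆ Z1 := sdiff_subset
  have hs : nb (gr L) Z2 \ (nb (gr L) Z ∪ (In L r w ∪ {r, w})) ⊆ nb (gr L) Z1 \ (C ∪ {r, v}) := by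
    rintro t ⟨ht, ht'⟩
    refine ⟨nb_mono hZ2 ht, ?_⟩
    rintro (h | rfl | rfl)
    · exact ht' (Or.inl (Or.inr ⟨v, hvZ, (hC h).2⟩))
    · exact ht' (Or.inr (Or.inr (Or.inl rfl)))
    · exact ht' (Or.inl (subset_nb hvZ))
  have hwr : ∀ t, rho (gr L) w t → t ∈ In L r w ∪ {r, w} := by
    rintro t (rfl | ht)
    · exact Or.inr (Or.inr rfl)
    · by_cases e : t = r
      · exact Or.inr (Or.inl e)
      · exact Or.inl ⟨e, ht⟩
  obtain ⟨h2, _, _, W2⟩ := W.1.ext (Z1 := Z2) (h1 := h1)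
    (by
      rintro z ⟨hz, hzw⟩ (hb | rfl | hb)
      · exact W1.disj z hz (Or.inl hb)
      · exact W1.disj z hz (Or.inr (Or.inl rfl))
      · exact hzw hb)
    ⟨fun t ht => ⟨W1.mt.maps t (hs ht), fun e => ht.2 (Or.inr (hwr t (e ▸ W1.mt.rel t (hs ht))))⟩,
      fun t ht => W1.mt.rel t (hs ht), W1.mt.inj.mono hs⟩ (W1.noray.mono hs)
  have hsub := W.2 _ _ W2
  obtain ⟨z, hz, hr⟩ := mem_nb_iff.1 hu1
  by_cases hzw : z = w
  · subst hzw
    exact Or.inr (hwr u hr)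
  · exact Or.inl (mem_nb_iff.2 ⟨z, hsub (Or.inr ⟨hz, hzw⟩), hr⟩)

lemma separation {E : Set (V × V)} {D : Set (V × V)} {r w : V} (hD : D = {e ∈ E | e.1 ≠ e.2 ∧ e.2 ≠ r})
    (hwr : w ≠ r) {Z T : Set V} (hB : ∀ z ∈ Z, z ∉ Bs D r w)
    (hcl : ∀ u v, (u, v) ∈ D → (v ∈ Z ∨ v = w) → u ≠ r → u ∈ T) :
    IsSeparation (E \ {(r, w)}) r w ((T \ Z) \ {r, w}) := by
  refine ⟨fun h => h.2 (Or.inl rfl), fun h => h.2 (Or.inr rfl), ?_⟩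
  intro p hs hl
  by_contra hne
  rw [not_nonempty_iff_eq_empty] at hne
  have key : ∀ (t : List V) (a : V), List.IsChain (fun a b => (a, b) ∈ E \ {(r, w)}) (a :: t) →
      (a :: t).Nodup → r ∉ t → (∀ x ∈ a :: t, x ∉ (T \ Z) \ {r, w}) →
      (a :: t).getLast (List.cons_ne_nil _ _) = w → a ≠ r ∧ (a ∈ Z ∨ a = w) := by
    intro t
    induction t with
    | nil =>
      intro a _ _ _ _ h
      simp only [List.getLast_singleton] at h
      exact ⟨h ▸ hwr, Or.inr h⟩
    | cons b t ih =>
      intro a hc hnd hr hx hlast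
      rw [List.isChain_cons_cons] at hc
      rw [List.getLast_cons (List.cons_ne_nil _ _)] at hlast
      have hb := ih b hc.2 (List.Nodup.of_cons hnd) (fun h => hr (List.mem_cons_of_mem _ h))
        (fun x h => hx x (List.mem_cons_of_mem _ h)) hlast
      have hab : a ≠ b := fun e => (List.nodup_cons.1 hnd).1 (e ▸ List.mem_cons_self)
      have hDab : (a, b) ∈ D := by rw [hD]; exact ⟨hc.1.1, hab, hb.1⟩
      have har : a ≠ r := by
        rintro rfl
        rcases hb.2 with h | h
        · exact hB b h (Or.inl hDab)
        · exact hc.1.2 (by rw [h]; rfl)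
      refine ⟨har, ?_⟩
      have hT := hcl a b hDab hb.2 har
      by_contra hc'
      push Not at hc'
      exact hx a List.mem_cons_self ⟨⟨hT, hc'.1⟩, by rintro (h | h); exacts [har h, hc'.2 h]⟩
  have hnd := p.nodup
  have := key p.rest p.start p.chain hnd (fun hr => (List.nodup_cons.1 hnd).1 (hs.symm ▸ hr))
    (fun x hx hxS => by
      have : x ∈ p.support ∩ ((T \ Z) \ {r, w}) := ⟨hx, hxS⟩
      rw [hne] at this; exact this) hl
  exact this.1 hs

end Flm

namespace Flm
open Set

def Lk (D : Set (V × V)) (r : V) (F : Set (V × V)) (w : V) (C : Set V) : Prop :=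
  ∃ p n, Link (gr F) (C ∪ {r, w}) (Bs D r w) p n

lemma Lk.mono {D F F' : Set (V × V)} {r w : V} {C C' : Set V} (H : Lk D r F w C) (hF : F ⊆ F')
    (hC : C' ⊆ C) : Lk D r F' w C' := by
  obtain ⟨p, n, L⟩ := H
  exact ⟨p, n, L.mono (gr_mono hF) (union_subset_union_left _ hC) le_rfl⟩

lemma Lk.unh {D F : Set (V × V)} {r w : V} {C : Set V} (H : Lk D r F w C) (hC : C.Finite) :
    Unh (gr F) (C ∪ {r, w}) (Bs D r w) := by
  obtain ⟨p, n, L⟩ := H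
  exact link_unh (hC.union (by simp)) L

lemma Lk.of_unh [Countable V] {D F : Set (V × V)} {r w : V} {C : Set V}
    (H : Unh (gr F) (C ∪ {r, w}) (Bs D r w)) : Lk D r F w C := menger H

/-- transfer of a wave to a bigger digraph -/
lemma Wave.transfer {G G' : V → V → Prop} {A B Z : Set V} {h : V → V} (W : Wave G A B Z h)
    (hG : ∀ x y, G x y → G' x y) (hs : nb G' Z \ A ⊆ nb G Z) :
    Wave G' A B Z h ∧ nb G' Z \ A = nb G Z \ A := by
  have e : nb G' Z \ A = nb G Z \ A :=
    Subset.antisymm (fun t ht => ⟨hs ht, ht.2⟩) (fun t ht => ⟨nb_gmono hG _ ht.1, ht.2⟩)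
  refine ⟨⟨W.disj, ?_, e ▸ W.noray⟩, e⟩
  rw [e]
  exact ⟨W.mt.maps, fun t ht => (W.mt.rel t ht).imp id (hG _ _), W.mt.inj⟩

def Inv1 (D : Set (V × V)) (r : V) (G : Set (V × V)) : Prop :=
  {e ∈ D | e.1 = r} ⊆ G ∧ G ⊆ D ∧ (∀ v, (In G r v).Finite) ∧ ∀ v, v ≠ r → Lk D r G v (In G r v)

lemma stage1_step [Countable V] {D G : Set (V × V)} {r u v : V} (hg : Good D r) (hI : Inv1 D r G)
    (huv : (u, v) ∈ D) (hur : u ≠ r) (hLk : Lk D r D v (insert u (In G r v))) :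
    ∃ G', Inv1 D r G' ∧ G ⊆ G' ∧ (u, v) ∈ G' := by
  classical
  obtain ⟨hR, hGD, hfin, hGl⟩ := hI
  have hvr : v ≠ r := (hg _ huv).2
  set C := insert u (In G r v) with hC
  have hCf : C.Finite := (hfin v).insert u
  have hCD : ∀ c ∈ C, c ≠ r ∧ (c, v) ∈ D := by
    rintro c (rfl | hc)
    · exact ⟨hur, huv⟩
    · exact ⟨hc.1, hGD hc.2⟩
  have hCv : ∀ c ∈ C, c ≠ v := fun c hc => (hg _ (hCD c hc).2).1
  obtain ⟨p, n, L⟩ := hLk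
  let P : Set (V × V) := {e | ∃ a ∈ C, ∃ m, m < n a ∧ e = (p a (m + 1), p a m)}
  have hPD : P ⊆ D := by
    rintro e ⟨a, ha, m, hm, rfl⟩
    exact L.step a (Or.inl ha) m hm
  have hPv : ∀ x, (x, v) ∉ P := by
    rintro x ⟨a, ha, m, hm, he⟩
    have he2 : v = p a m := (Prod.ext_iff.1 he).2
    have hvm : v ∈ C ∪ {r, v} := Or.inr (Or.inr rfl)
    exact hCv a ha (L.inj a (Or.inl ha) v hvm m 0 hm.le (Nat.zero_le _)
      (he2.symm.trans (L.start v hvm).symm)).1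
  have hPuniq : ∀ x y y', (y, x) ∈ P → (y', x) ∈ P → y = y' := by
    rintro x y y' ⟨a, ha, m, hm, he⟩ ⟨a', ha', m', hm', he'⟩
    obtain ⟨h1, h2⟩ := Prod.ext_iff.1 he
    obtain ⟨h1', h2'⟩ := Prod.ext_iff.1 he'
    simp only at h1 h2 h1' h2'
    obtain ⟨rfl, rfl⟩ := L.inj a (Or.inl ha) a' (Or.inl ha') m m' hm.le hm'.le (h2.symm.trans h2')
    rw [h1, h1']
  have hPf : P.Finite := by
    have : P = ⋃ a ∈ C, (fun m => (p a (m + 1), p a m)) '' Iio (n a) := by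
      ext e
      simp only [mem_iUnion, mem_image, mem_Iio, exists_prop]
      constructor
      · rintro ⟨a, ha, m, hm, rfl⟩; exact ⟨a, ha, m, hm, rfl⟩
      · rintro ⟨a, ha, m, hm, rfl⟩; exact ⟨a, ha, m, hm, rfl⟩
    rw [this]
    exact hCf.biUnion (fun a _ => (finite_Iio _).image _)
  let G1 := insert (u, v) G
  have hLkP : Lk D r (G1 ∪ P) v C := by
    refine ⟨p, fun a => if a ∈ C then n a else 0, ⟨L.start, ?_, ?_, ?_⟩⟩
    · intro a _ m hm
      by_cases ha : a ∈ C
      · simp only [ha, if_true] at hm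
        exact Or.inr ⟨a, ha, m, hm, rfl⟩
      · simp only [ha, if_false] at hm; omega
    · intro a ha
      by_cases haC : a ∈ C
      · simp only [haC, if_true]; exact L.fin a ha
      · simp only [haC, if_false]
        rw [L.start a ha]
        exact Or.inr (ha.resolve_left haC)
    · have hle : ∀ a, (if a ∈ C then n a else 0) ≤ n a := by intro a; split_ifs <;> omega
      intro a ha a' ha' m m' hm hm' he
      exact L.inj a ha a' ha' m m' (hm.trans (hle a)) (hm'.trans (hle a')) he
  obtain ⟨Y, hY, hYmin⟩ := (Set.Finite.subset hPf.finite_subsets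
    (show {Y | Y ⊆ P ∧ Lk D r (G1 ∪ Y) v C} ⊆ {Y | Y ⊆ P} from fun Y h => h.1)).exists_minimal
    ⟨P, Subset.rfl, hLkP⟩
  obtain ⟨hYP, hYL⟩ := hY
  set H := G1 ∪ Y with hH
  have hGH : G ⊆ H := fun e he => Or.inl (Or.inr he)
  have hHD : H ⊆ D := by
    rintro e ((rfl | he) | he)
    · exact huv
    · exact hGD he
    · exact hPD (hYP he)
  have hInv : In H r v = C := by
    ext x
    constructor
    · rintro ⟨hx, (he | he) | he⟩
      · exact Or.inl (Prod.ext_iff.1 he).1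
      · exact Or.inr ⟨hx, he⟩
      · exact (hPv x (hYP he)).elim
    · intro hx
      refine ⟨(hCD x hx).1, ?_⟩
      rcases hx with rfl | hx
      · exact Or.inl (Or.inl rfl)
      · exact hGH hx.2
  have hBs : ∀ b, (r, b) ∈ D → (r, b) ∈ H := fun b hb => hGH (hR ⟨hb, rfl⟩)
  refine ⟨H, ⟨hR.trans hGH, hHD, ?_, ?_⟩, hGH, Or.inl (Or.inl rfl)⟩
  · intro x
    have : In H r x ⊆ insert u (In G r x) ∪ Prod.fst '' P := by
      rintro y ⟨hy, (he | he) | he⟩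
      · exact Or.inl (Or.inl (Prod.ext_iff.1 he).1)
      · exact Or.inl (Or.inr ⟨hy, he⟩)
      · exact Or.inr ⟨_, hYP he, rfl⟩
    exact (((hfin x).insert u).union (hPf.image _)).subset this
  · intro x hxr
    by_cases hxv : x = v
    · subst hxv; rw [hInv]; exact hYL
    by_cases hex : ∃ y, (y, x) ∈ Y ∧ (y, x) ∉ G
    swap
    · refine (hGl x hxr).mono hGH ?_
      rintro y ⟨hy, (he | he) | he⟩
      · exact (hxv (Prod.ext_iff.1 he).2).elim
      · exact ⟨hy, he⟩
      · refine ⟨hy, ?_⟩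
        by_contra hn
        exact hex ⟨y, he, hn⟩
    obtain ⟨y, hyY, hyG⟩ := hex
    have hyr : y ≠ r := fun e => hyG (hR ⟨hPD (hYP hyY), e⟩)
    have hsub : In H r x ⊆ insert y (In G r x) := by
      rintro z ⟨hz, (he | he) | he⟩
      · exact (hxv (Prod.ext_iff.1 he).2).elim
      · exact Or.inr ⟨hz, he⟩
      · exact Or.inl (hPuniq x z y (hYP he) (hYP hyY))
    suffices hmain : Lk D r H x (insert y (In G r x)) from hmain.mono Subset.rfl hsub
    by_contra hcon
    let f : V × V := (y, x)
    let LL := G1 ∪ (Y \ {f})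
    have hfG1 : f ∉ G1 := by
      rintro (h | h)
      · exact hxv (Prod.ext_iff.1 h).2
      · exact hyG h
    have hLH : LL ⊆ H := union_subset_union_right _ sdiff_subset
    have hGL : G ⊆ LL := fun e he => Or.inl (Or.inr he)
    have hHL : ∀ e ∈ H, e ∉ LL → e = f := by
      rintro e (he | he) hn
      · exact (hn (Or.inl he)).elim
      · by_contra h
        exact hn (Or.inr ⟨he, h⟩)
    have hInx : In LL r x = In G r x := by
      refine Subset.antisymm ?_ (In_mono hGL r x)
      rintro z hz
      rcases hsub (In_mono hLH r x hz) with rfl | h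
      · exfalso
        rcases hz.2 with h | h
        · exact hfG1 h
        · exact h.2 rfl
      · exact h
    have hdomf : Dom D r LL x y := by
      have hu1 : Unh (gr LL) (In G r x ∪ {r, x}) (Bs D r x) := ((hGl x hxr).mono hGL Subset.rfl).unh (hfin x)
      have hu2 : ¬ Unh (gr LL) (insert y (In G r x ∪ {r, x})) (Bs D r x) := by
        intro h
        rw [← insert_union] at h
        exact hcon ((Lk.of_unh h).mono hLH Subset.rfl)
      obtain ⟨Z, h, W, hy⟩ := dominate hu1 hu2
      exact ⟨In G r x, hInx ▸ Subset.rfl, Z, h, W, hy⟩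
    have hInLv : In LL r v = C := by
      refine Subset.antisymm (hInv ▸ In_mono hLH r v) ?_
      intro c hc
      refine ⟨(hCD c hc).1, ?_⟩
      rcases hc with rfl | hc
      · exact Or.inl (Or.inl rfl)
      · exact hGL hc.2
    have hunh : Unh (gr LL) (C ∪ {r, v}) (Bs D r v) := by
      by_contra hh
      obtain ⟨Z, h, W⟩ := exists_gwave (gr LL) (C ∪ {r, v}) (Bs D r v)
      obtain ⟨h', W', hns⟩ := hindered_gwave W hh
      have W'' := W'
      rw [← hInLv] at W''
      have hs : nb (gr H) Z \ (C ∪ {r, v}) ⊆ nb (gr LL) Z := by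
        rintro t ⟨ht | ⟨z, hz, ht⟩, htA⟩
        · exact subset_nb ht
        · have := closed (D' := H) (fun a b hab hn => by
            obtain ⟨rfl, rfl⟩ := Prod.ext_iff.1 (hHL _ hab hn)
            exact hdomf) W'' ht (Or.inl hz) (fun e => htA (Or.inr (Or.inl e)))
          rw [hInLv] at this
          exact this.resolve_right htA
      obtain ⟨W3, he⟩ := W'.1.transfer (gr_mono hLH) hs
      have := hYL.unh hCf Z h' W3
      rw [he] at this
      exact hns this
    have hle := hYmin ⟨(sdiff_subset.trans hYP : Y \ {f} ⊆ P), Lk.of_unh hunh⟩ sdiff_subset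
    exact (hle hyY).2 rfl

def FinL (D : Set (V × V)) (r : V) (F : Set (V × V)) : Prop :=
  ∀ v, v ≠ r → ∀ C ⊆ In F r v, C.Finite → Lk D r F v C

theorem stage1 [Countable V] {D : Set (V × V)} {r : V} (hg : Good D r) :
    ∃ F, {e ∈ D | e.1 = r} ⊆ F ∧ F ⊆ D ∧ FinL D r F ∧
      ∀ u v, (u, v) ∈ D → (u, v) ∉ F → ∃ C ⊆ In F r v, C.Finite ∧ ¬ Lk D r D v (insert u C) := by
  classical
  have : Nonempty (V × V) := ⟨(r, r)⟩
  obtain ⟨en, hen⟩ := exists_surjective_nat (V × V)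
  let cond : Set (V × V) → V × V → Prop := fun G e => Inv1 D r G ∧ e ∈ D ∧ e.1 ≠ r ∧
    Lk D r D e.2 (insert e.1 (In G r e.2))
  have hst : ∀ G e, ∃ G', G ⊆ G' ∧ (Inv1 D r G → Inv1 D r G') ∧ (cond G e → e ∈ G') := by
    intro G e
    by_cases hc : cond G e
    · obtain ⟨G', h1, h2, h3⟩ := stage1_step (u := e.1) (v := e.2) hg hc.1 hc.2.1 hc.2.2.1 hc.2.2.2
      exact ⟨G', h2, fun _ => h1, fun _ => h3⟩
    · exact ⟨G, Subset.rfl, id, fun h => (hc h).elim⟩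
  choose st hs1 hs2 hs3 using hst
  let G : ℕ → Set (V × V) := fun n => Nat.rec (motive := fun _ => Set (V × V)) {e ∈ D | e.1 = r}
    (fun n G => st G (en n)) n
  have G0 : G 0 = {e ∈ D | e.1 = r} := rfl
  have Gs : ∀ n : ℕ, G (n + 1) = st (G n) (en n) := fun n => rfl
  have hinv : ∀ n, Inv1 D r (G n) := by
    intro n
    induction n with
    | zero =>
      rw [G0]
      have he : ∀ v, In {e ∈ D | e.1 = r} r v = ∅ := by
        intro v
        ext x
        simp only [In, mem_ofPred_eq, mem_empty_iff_false, iff_false, not_and]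
        exact fun h1 _ h2 => h1 h2
      refine ⟨Subset.rfl, fun e he => he.1, fun v => by rw [he]; exact finite_empty, fun v hv => ?_⟩
      rw [he]
      refine ⟨fun a _ => a, fun _ => 0, ⟨fun _ _ => rfl, fun _ _ m hm => by omega, fun a ha => ?_, ?_⟩⟩
      · rcases ha with h | h
        · exact h.elim
        · exact Or.inr h
      · intro a _ a' _ m m' hm hm' h
        exact ⟨h, by omega⟩
    | succ n ih => rw [Gs]; exact hs2 _ _ ih
  have hmono : Monotone G := monotone_nat_of_le_succ (fun n => by rw [Gs]; exact hs1 _ _)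
  have hGF : ∀ n, G n ⊆ ⋃ n, G n := fun n => subset_iUnion _ n
  refine ⟨⋃ n, G n, (hinv 0).1.trans (hGF 0), iUnion_subset fun n => (hinv n).2.1, ?_, ?_⟩
  · intro v hv C hC hCf
    have : ∃ n, C ⊆ In (G n) r v := by
      clear * - hC hCf hmono
      induction C, hCf using Set.Finite.induction_on with
      | empty => exact ⟨0, empty_subset _⟩
      | @insert c C _ _ ih =>
        obtain ⟨n, hn⟩ := ih ((subset_insert _ _).trans hC)
        have hc := hC (mem_insert _ _)
        obtain ⟨m, hm⟩ := mem_iUnion.1 hc.2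
        refine ⟨max n m, insert_subset ⟨hc.1, hmono (le_max_right _ _) hm⟩
          (hn.trans (In_mono (hmono (le_max_left _ _)) r v))⟩
    obtain ⟨n, hn⟩ := this
    exact ((hinv n).2.2.2 v hv).mono (hGF n) hn
  · intro u v huv hn
    obtain ⟨n, hne⟩ := hen (u, v)
    refine ⟨In (G n) r v, In_mono (hGF n) r v, (hinv n).2.2.1 v, fun hL => hn ?_⟩
    have hur : u ≠ r := fun e => hn (hGF 0 ⟨huv, e⟩)
    refine hGF (n + 1) ?_
    rw [Gs, hne]
    exact hs3 _ _ ⟨hinv n, huv, hur, hL⟩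

end Flm

namespace Flm
open Set

def Ok (E D : Set (V × V)) (r : V) (L : Set (V × V)) (w : V) : Prop :=
  (∀ u, (u, w) ∈ D → (u, w) ∉ L → Dom D r L w u) ∧ inEdges L w ∈ GSet L r w ∧ VLarge E r L w

lemma Link.trim {G : V → V → Prop} {A B : Set V} {p : V → ℕ → V} {n : V → ℕ} (L : Link G A B p n)
    {v : V} (hv : v ∈ B) : ∃ n', n' v = 0 ∧ Link G A B p n' := by
  classical
  have hle : ∀ s, (if s = v then 0 else n s) ≤ n s := by
    intro s; split_ifs <;> omega
  refine ⟨fun s => if s = v then 0 else n s, by simp, L.start, ?_, ?_, ?_⟩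
  · intro a ha m hm
    exact L.step a ha m (lt_of_lt_of_le hm (hle a))
  · intro a ha
    by_cases h : a = v
    · subst h
      simp only [if_true]
      rw [L.start a ha]
      exact hv
    · simp only [if_neg h]
      exact L.fin a ha
  · intro a ha a' ha' m m' hm hm' h
    exact L.inj a ha a' ha' m m' (hm.trans (hle a)) (hm'.trans (hle a')) h

lemma stage2_step [Countable V] {E D F Fr : Set (V × V)} {r v : V}
    (hD : D = {e ∈ E | e.1 ≠ e.2 ∧ e.2 ≠ r}) (hvr : v ≠ r)
    (hR : {e ∈ D | e.1 = r} ⊆ Fr) (hFr : Fr ⊆ F) (hFD : F ⊆ D) (hFin : FinL D r F)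
    (hdom : ∀ u x, (u, x) ∈ D → (u, x) ∉ F → Dom D r F x u) (hK : (In Fr r v).Finite) :
    ∃ F' Fr' : Set (V × V), Fr ⊆ Fr' ∧ Fr' ⊆ F' ∧ F' ⊆ F ∧ FinL D r F' ∧
      (∀ w, w ≠ v → In F' r w = In F r w) ∧
      (∀ w, w ≠ v → (In Fr r w).Finite → (In Fr' r w).Finite) ∧
      ∀ L, Fr' ⊆ L → L ⊆ F' → Ok E D r L v := by
  classical
  have hDE : D ⊆ E := by rw [hD]; exact fun e he => he.1
  have hg : Good D r := by rw [hD]; exact fun e he => he.2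
  obtain ⟨Z, h0, W⟩ := exists_gwave (gr F) (In F r v ∪ {r, v}) (Bs D r v)
  have hcl : ∀ u x, (u, x) ∈ D → (x ∈ Z ∨ x = v) → u ≠ r →
      u ∈ nb (gr F) Z ∪ (In F r v ∪ {r, v}) := fun u x hux hx hu => closed hdom W hux hx hu
  have hsep := separation hD hvr W.1.disj hcl
  obtain ⟨I, h, H⟩ := swap (A0 := {r, v}) (K := In Fr r v) W.1 subset_union_right
    (subset_union_right) ((In_mono hFr r v).trans subset_union_left) hK
    ((hFin v hvr _ (In_mono hFr r v) hK).unh hK)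
  obtain ⟨q, nq0, Q0⟩ := menger (beyond W)
  have hvB : v ∈ Bs D r v := Or.inr (Or.inr rfl)
  have hrB : r ∈ Bs D r v := Or.inr (Or.inl rfl)
  obtain ⟨nq, hnq, Q⟩ := Q0.trim (v := v) (Or.inl hvB)
  obtain ⟨l, N, k, K, hk, hS⟩ := concat H Q
  have hvZ : v ∉ Z := fun h => W.1.disj v h hvB
  have hrZ : r ∉ Z := fun h => W.1.disj r h hrB
  have hrI : r ∈ I := H.K_sub (Or.inr (Or.inl rfl))
  have hvI : v ∈ I := H.K_sub (Or.inr (Or.inr rfl))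
  set U := Used (gr F) (In F r v ∪ {r, v}) Z I h q nq with hU
  have hUF : ∀ x y, U x y → (y, x) ∈ F := fun x y hxy => used_sub H.wave Q hxy
  have hUv : ∀ y, ¬ U v y := by
    rintro y (⟨t, ht, -, h1, -⟩ | ⟨s, hs, m, hm, h1, -⟩)
    · exact hvZ (h1 ▸ H.wave.mt.maps t ht)
    · have hvT : v ∈ nb (gr F) Z ∪ (In F r v ∪ {r, v}) := Or.inr (Or.inr (Or.inr rfl))
      have := (Q.inj s hs.1 v hvT m 0 hm.le (Nat.zero_le _) (h1.symm.trans (Q.start v hvT).symm)).1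
      subst this
      omega
  let F' : Set (V × V) := {e ∈ F | e.2 = v → e.1 ∈ I}
  let Fr' : Set (V × V) := {e | e ∈ Fr ∨ U e.2 e.1 ∨ (e ∈ F ∧ e.2 = v ∧ e.1 ∈ I)}
  have hFrFr' : Fr ⊆ Fr' := fun e he => Or.inl he
  have hF'F : F' ⊆ F := fun e he => he.1
  have hFr'F' : Fr' ⊆ F' := by
    rintro ⟨x, y⟩ (he | he | he)
    · refine ⟨hFr he, fun h => ?_⟩
      simp only at h
      subst h
      by_cases hx : x = r
      · exact hx ▸ hrI
      · exact H.K_sub (Or.inl ⟨hx, he⟩)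
    · refine ⟨hUF _ _ he, fun h => ?_⟩
      simp only at h
      subst h
      exact (hUv _ he).elim
    · exact ⟨he.1, fun _ => he.2.2⟩
  have hInL : ∀ L, Fr' ⊆ L → L ⊆ F' → In L r v ∪ {r, v} = I := by
    intro L h1 h2
    ext i
    constructor
    · rintro (hi | rfl | rfl)
      · exact (h2 hi.2).2 rfl
      · exact hrI
      · exact hvI
    · intro hi
      rcases H.I_sub hi with hi' | hi'
      · exact Or.inl ⟨hi'.1, h1 (Or.inr (Or.inr ⟨hi'.2, rfl, hi⟩))⟩
      · exact Or.inr hi'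
  have hUL : ∀ L, Fr' ⊆ L → ∀ x y, U x y → gr L x y := fun L h1 x y hxy => h1 (Or.inr (Or.inl hxy))
  have hRD : ∀ L, Fr' ⊆ L → ∀ b, (r, b) ∈ D → (r, b) ∈ L := fun L h1 b hb => h1 (Or.inl (hR ⟨hb, rfl⟩))
  refine ⟨F', Fr', hFrFr', hFr'F', hF'F, ?_, ?_, ?_, ?_⟩
  · intro w hw C hC hCf
    by_cases hwv : w = v
    · subst hwv
      refine ⟨l, N, K.mono (hUL F' hFr'F') ?_ le_rfl⟩
      rw [← hInL F' hFr'F' Subset.rfl]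
      exact union_subset_union_left _ hC
    apply Lk.of_unh
    intro Z' h' W'
    have hA'f : (C ∪ {r, w}).Finite := hCf.union (by simp)
    by_cases hs : nb (gr F) Z' \ (C ∪ {r, w}) ⊆ nb (gr F') Z'
    · obtain ⟨W2, e⟩ := W'.transfer (gr_mono hF'F) hs
      have := (hFin w hw C (hC.trans (In_mono hF'F r w)) hCf).unh hCf Z' h' W2
      rwa [e] at this
    exfalso
    rw [not_subset] at hs
    obtain ⟨t, ⟨ht1, -⟩, ht2⟩ := hs
    have hex : v ∈ Z' ∧ t ∉ I ∧ (t, v) ∈ F := by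
      rcases ht1 with ht1 | ⟨z, hz, hzt⟩
      · exact (ht2 (Or.inl ht1)).elim
      · have : ¬ ((z = v) → t ∈ I) := fun hh => ht2 (Or.inr ⟨z, hz, hzt, hh⟩)
        push Not at this
        obtain ⟨rfl, h2⟩ := this
        exact ⟨hz, h2, hzt⟩
    obtain ⟨hvZ', htI, htF⟩ := hex
    have htr : t ≠ r := fun h => htI (h ▸ hrI)
    have hInf : ¬ I.Finite := by
      intro hIf
      have hI0 : insert t (In F' r v) ⊆ In F r v :=
        insert_subset ⟨htr, htF⟩ (In_mono hF'F r v)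
      have hI0f : (insert t (In F' r v)).Finite := by
        refine (hIf.subset ?_).insert t
        rw [← hInL F' hFr'F' Subset.rfl]
        exact subset_union_left
      have hu := (hFin v hvr _ hI0 hI0f).unh hI0f
      rw [insert_union, hInL F' hFr'F' Subset.rfl] at hu
      have hsub : nb (gr F) Z \ insert t I ⊆ nb (gr F) Z \ I :=
        fun x hx => ⟨hx.1, fun h => hx.2 (Or.inr h)⟩
      have := hu Z h ⟨H.wave.disj, H.wave.mt.mono hsub, H.wave.noray.mono hsub⟩
      have htn : t ∈ nb (gr F) Z \ I := by
        rcases H.A_sub (Or.inl ⟨htr, htF⟩) with h1 | h1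
        · exact ⟨h1, htI⟩
        · exact (htI h1).elim
      obtain ⟨t', ht', e⟩ := this (H.wave.mt.maps t htn)
      have := H.wave.mt.inj (hsub ht') htn e
      exact ht'.2 (Or.inl this)
    have hL0 : Link (gr F') (I \ {r, v}) (Bs D r w) l N := by
      refine ⟨fun a ha => K.start a ha.1, fun a ha m hm => hUL F' hFr'F' _ _ (K.step a ha.1 m hm),
        fun a ha => ?_, fun a ha a' ha' => K.inj a ha.1 a' ha'.1⟩
      rcases K.fin a ha.1 with hb | hb | hb
      · exact Or.inl hb
      · exact (ha.2 (Or.inl (K.inj a ha.1 r hrI _ 0 le_rfl (Nat.zero_le _)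
          (hb.trans (K.start r hrI).symm)).1)).elim
      · exact (ha.2 (Or.inr (K.inj a ha.1 v hvI _ 0 le_rfl (Nat.zero_le _)
          (Eq.trans hb (K.start v hvI).symm)).1)).elim
    obtain ⟨s, hsi, hsm⟩ := first_exit (T := nb (gr F') Z' ∪ (C ∪ {r, w})) hL0 (by
      rintro i ⟨hi, hi2⟩
      rw [← hInL F' hFr'F' Subset.rfl] at hi
      rcases hi with hi | hi
      · exact Or.inl (Or.inr ⟨v, hvZ', hi.2⟩)
      · exact (hi2 hi).elim) subset_union_left W'.disj
    have hfin0 : (I \ {r, v}).Finite :=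
      Set.Finite.of_injOn (fun a ha => hsm a ha) hsi (W'.bdry_finite hA'f)
    apply hInf
    refine (hfin0.union (show ({r, v} : Set V).Finite by simp)).subset ?_
    intro x hx
    by_cases hx2 : x ∈ ({r, v} : Set V)
    · exact Or.inr hx2
    · exact Or.inl ⟨hx, hx2⟩
  · intro w hw
    ext i
    exact ⟨fun hi => ⟨hi.1, hi.2.1⟩, fun hi => ⟨hi.1, hi.2, fun h => (hw h).elim⟩⟩
  · intro w hw hf
    have hsub : {y | U w y}.Subsingleton := fun y hy y' hy' => used_unique H.wave Q hy hy'
    refine (hf.union hsub.finite).subset ?_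
    rintro i ⟨hi, h1 | h1 | h1⟩
    · exact Or.inl ⟨hi, h1⟩
    · exact Or.inr h1
    · exact (hw h1.2.1).elim
  · intro L h1 h2
    have eI := hInL L h1 h2
    have hLD : L ⊆ D := h2.trans (hF'F.trans hFD)
    have hLF : L ⊆ F := h2.trans hF'F
    have hst : ∀ t ∈ nb (gr F) Z \ I, rho (gr L) (h t) t := by
      intro t ht
      by_cases he : h t = t
      · exact Or.inl he
      · exact Or.inr (hUL L h1 _ _ (Or.inl ⟨t, ht, he, rfl, rfl⟩))
    have hLK : Link (gr L) (In L r v ∪ {r, v}) (Bs D r v) l N := by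
      rw [eI]; exact K.mono (hUL L h1) le_rfl le_rfl
    refine ⟨?_, gset_of hg hLD hvr (hRD L h1) hLK, ?_⟩
    · intro u hu huL
      have hur : u ≠ r := by
        rintro rfl
        exact huL (hRD L h1 v hu)
      have huv : u ≠ v := (hg _ hu).1
      have huI : u ∉ I := by
        intro hi
        rw [← eI] at hi
        rcases hi with hi | hi | hi
        · exact huL hi.2
        · exact hur hi
        · exact huv hi
      have hun : u ∈ nb (gr F) Z \ I := by
        refine ⟨?_, huI⟩
        rcases hcl u v hu (Or.inr rfl) hur with h3 | h3
        · exact h3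
        · exact (H.A_sub h3).resolve_right huI
      have hsub : nb (gr L) Z \ I ⊆ nb (gr F) Z \ I :=
        fun x hx => ⟨nb_gmono (gr_mono hLF) _ hx.1, hx.2⟩
      refine ⟨In L r v, Subset.rfl, Z, h, ?_, ?_⟩
      · rw [eI]
        exact ⟨H.wave.disj, ⟨fun t ht => H.wave.mt.maps t (hsub ht), fun t ht => hst t (hsub ht),
          H.wave.mt.inj.mono hsub⟩, H.wave.noray.mono hsub⟩
      · exact mem_nb_iff.2 ⟨h u, H.wave.mt.maps u hun, hst u hun⟩
    · refine vlarge_of hDE hg hLD hvr (hRD L h1) ?_ (S := (nb (gr F) Z ∪ (In F r v ∪ {r, v})) \ Z)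
        ⟨Or.inr (Or.inr (Or.inl rfl)), hrZ⟩ ⟨Or.inr (Or.inr (Or.inr rfl)), hvZ⟩ hsep (k := k) hLK ?_ ?_
      · intro he
        rw [hD]
        exact ⟨he, fun h => hvr h.symm, hvr⟩
      · rw [eI]; exact hk
      · rw [eI]; exact hS

/-- the invariant of the second stage, `Hd` being the set of handled vertices -/
structure Inv2 (E D F0 : Set (V × V)) (r : V) (F Fr : Set (V × V)) (Hd : Set V) : Prop where
  root : {e ∈ D | e.1 = r} ⊆ Fr
  sub : Fr ⊆ F
  subD : F ⊆ D
  finL : FinL D r F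
  fin : ∀ w, w ∉ Hd → (In Fr r w).Finite
  same : ∀ w, w ∉ Hd → In F r w = In F0 r w
  ok : ∀ w ∈ Hd, w ≠ r → ∀ L, Fr ⊆ L → L ⊆ F → Ok E D r L w

lemma Inv2.step [Countable V] {E D F0 F Fr : Set (V × V)} {r : V} {Hd : Set V}
    (hD : D = {e ∈ E | e.1 ≠ e.2 ∧ e.2 ≠ r})
    (h0 : ∀ u v, (u, v) ∈ D → (u, v) ∉ F0 → ∃ C ⊆ In F0 r v, C.Finite ∧ ¬ Lk D r D v (insert u C))
    (hI : Inv2 E D F0 r F Fr Hd) (v : V) :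
    ∃ F' Fr' : Set (V × V), ∃ Hd' : Set V, Fr ⊆ Fr' ∧ F' ⊆ F ∧ Hd ⊆ Hd' ∧ v ∈ Hd' ∧ Inv2 E D F0 r F' Fr' Hd' := by
  classical
  have hg : Good D r := by rw [hD]; exact fun e he => he.2
  by_cases hv : v ∈ Hd
  · exact ⟨F, Fr, Hd, Subset.rfl, Subset.rfl, Subset.rfl, hv, hI⟩
  by_cases hvr : v = r
  · refine ⟨F, Fr, insert v Hd, Subset.rfl, Subset.rfl, subset_insert _ _, mem_insert _ _,
      hI.root, hI.sub, hI.subD, hI.finL, fun w hw => hI.fin w fun h => hw (Or.inr h),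
      fun w hw => hI.same w fun h => hw (Or.inr h), ?_⟩
    rintro w (rfl | hw) hwr
    · exact (hwr hvr).elim
    · exact hI.ok w hw hwr
  have hdom : ∀ u x, (u, x) ∈ D → (u, x) ∉ F → Dom D r F x u := by
    intro u x hux huF
    have hxr : x ≠ r := (hg _ hux).2
    by_cases hx : x ∈ Hd
    · exact (hI.ok x hx hxr F hI.sub Subset.rfl).1 u hux huF
    · have hur : u ≠ r := by
        rintro rfl
        exact huF (hI.sub (hI.root ⟨hux, rfl⟩))
      have hu0 : (u, x) ∉ F0 := by
        intro hu
        have : u ∈ In F0 r x := ⟨hur, hu⟩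
        rw [← hI.same x hx] at this
        exact huF this.2
      obtain ⟨C, hC, hCf, hn⟩ := h0 u x hux hu0
      rw [← hI.same x hx] at hC
      have hnu : ¬ Unh (gr F) (insert u (C ∪ {r, x})) (Bs D r x) := by
        intro hu
        rw [← insert_union] at hu
        exact hn ((Lk.of_unh hu).mono hI.subD Subset.rfl)
      obtain ⟨Z, h, W, huZ⟩ := dominate ((hI.finL x hxr C hC hCf).unh hCf) hnu
      exact ⟨C, hC, Z, h, W, huZ⟩
  obtain ⟨F', Fr', h1, h2, h3, h4, h5, h6, h7⟩ :=
    stage2_step hD hvr hI.root hI.sub hI.subD hI.finL hdom (hI.fin v hv)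
  refine ⟨F', Fr', insert v Hd, h1, h3, subset_insert _ _, mem_insert _ _,
    hI.root.trans h1, h2, h3.trans hI.subD, h4, ?_, ?_, ?_⟩
  · intro w hw
    exact h6 w (fun h => hw (Or.inl h)) (hI.fin w fun h => hw (Or.inr h))
  · intro w hw
    rw [h5 w (fun h => hw (Or.inl h))]
    exact hI.same w fun h => hw (Or.inr h)
  · rintro w (rfl | hw) hwr L hL1 hL2
    · exact h7 L hL1 hL2
    · exact hI.ok w hw hwr L (h1.trans hL1) (hL2.trans h3)

theorem main [Countable V] (E : Set (V × V)) (r : V) :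
    ∃ F ⊆ E, IsFlame F r ∧ Large E r F := by
  classical
  obtain ⟨D, hD⟩ : ∃ D : Set (V × V), D = {e ∈ E | e.1 ≠ e.2 ∧ e.2 ≠ r} := ⟨_, rfl⟩
  have hg : Good D r := by rw [hD]; exact fun e he => he.2
  have hDE : D ⊆ E := by rw [hD]; exact fun e he => he.1
  obtain ⟨F0, hR0, hF0, hfin0, h0⟩ := stage1 hg
  let St := {x : Set (V × V) × Set (V × V) × Set V // Inv2 E D F0 r x.1 x.2.1 x.2.2}
  have hinit : Inv2 E D F0 r F0 {e ∈ D | e.1 = r} ∅ := by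
    refine ⟨Subset.rfl, hR0, hF0, hfin0, fun w _ => ?_, fun _ _ => rfl, fun w hw => hw.elim⟩
    have : In {e ∈ D | e.1 = r} r w = ∅ := by
      ext x
      simp only [In, mem_ofPred_eq, mem_empty_iff_false, iff_false, not_and]
      exact fun h1 _ h2 => h1 h2
    rw [this]; exact finite_empty
  have hst : ∀ (s : St) (v : V), ∃ s' : St, s.1.2.1 ⊆ s'.1.2.1 ∧ s'.1.1 ⊆ s.1.1 ∧
      s.1.2.2 ⊆ s'.1.2.2 ∧ v ∈ s'.1.2.2 := by
    intro s v
    obtain ⟨F', Fr', Hd', a, b, c, d, e⟩ := s.2.step hD h0 v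
    exact ⟨⟨(F', Fr', Hd'), e⟩, a, b, c, d⟩
  choose nx hn1 hn2 hn3 hn4 using hst
  have : Nonempty V := ⟨r⟩
  obtain ⟨en, hen⟩ := exists_surjective_nat V
  let S : ℕ → St := fun n => Nat.rec (motive := fun _ => St) ⟨(F0, {e ∈ D | e.1 = r}, ∅), hinit⟩
    (fun n s => nx s (en n)) n
  have hS : ∀ n, S (n + 1) = nx (S n) (en n) := fun n => rfl
  have m1 : Monotone fun n => (S n).1.2.1 :=
    monotone_nat_of_le_succ fun n => by rw [hS]; exact hn1 _ _
  have m2 : Antitone fun n => (S n).1.1 :=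
    antitone_nat_of_succ_le fun n => by rw [hS]; exact hn2 _ _
  let L := ⋃ n, (S n).1.2.1
  have hL1 : ∀ n, (S n).1.2.1 ⊆ L := fun n => subset_iUnion (fun n => (S n).1.2.1) n
  have hL2 : ∀ n, L ⊆ (S n).1.1 := by
    intro n
    refine iUnion_subset fun m => ?_
    exact ((m1 (le_max_left m n)).trans (S (max m n)).2.sub).trans (m2 (le_max_right m n))
  have hok : ∀ w, w ≠ r → Ok E D r L w := by
    intro w hw
    obtain ⟨n, rfl⟩ := hen w
    exact (S (n + 1)).2.ok _ (by rw [hS]; exact hn4 _ _) hw L (hL1 (n + 1)) (hL2 (n + 1))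
  exact ⟨L, ((hL2 0).trans (S 0).2.subD).trans hDE, fun v hv => (hok v hv).2.1,
    fun v hv => (hok v hv).2.2⟩

end Flm
/-- Every countable rooted digraph contains a large vertex-flame. -/
theorem stmt18 {V : Type u} [Countable V] (E : Set (V × V)) (r : V) :
    ∃ F ⊆ E, IsFlame F r ∧ Large E r F := by
  exact Flm.main E r
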